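/- There is a constant K(f, I) such that for all integers J ≥ 2 and q₀ ≥ 2, the sum over all pairs of integers (j₁,j₂) with |j₁| ≤ J, |j₂| ≤ J, (j₁,j₂) ≠ (0,0), of the integral ∫_I min(q₀, ‖j₁β + j₂f(β)‖^{−1}) dβ is at most K(f,I)(J² log q₀ + q₀^{1/2} J^{1/2} log J). -/

import Mathlib

open Set Real MeasureTheory
open scoped Classical

/-- Distance from a real number to the nearest integer. -/
noncomputable def nint (y : ℝ) : ℝ := |y - round y|

/-- The quantitative features of the arc `y = f x`, `x ∈ [ξ, η]`, with derivative `f'`, that enter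
the counting argument: `f'` is bounded, monotone and bi-Lipschitz, and the tangent lines move away
from a given point at a quadratic rate. -/
structure CurvedArc (ξ η c C : ℝ) (f f' : ℝ → ℝ) : Prop where
  c_pos : 0 < c
  c_le_one : c ≤ 1
  one_le_C : 1 ≤ C
  length_le : η - ξ ≤ C
  abs_deriv_le : ∀ x ∈ Icc ξ η, |f' x| ≤ C
  lower : ∀ x ∈ Icc ξ η, ∀ y ∈ Icc ξ η, c * |x - y| ≤ |f' x - f' y|
  upper : ∀ x ∈ Icc ξ η, ∀ y ∈ Icc ξ η, |f' x - f' y| ≤ C * |x - y|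
  slope : ∀ x ∈ Icc ξ η, ∀ y ∈ Icc ξ η, x ≤ y → ∃ z ∈ Icc x y, f y - f x = f' z * (y - x)
  between : ∀ x ∈ Icc ξ η, ∀ y ∈ Icc ξ η, ∀ z ∈ Icc x y, f' z ∈ uIcc (f' x) (f' y)
  tangent : ∀ X, ∀ x ∈ Icc ξ η, ∀ y ∈ Icc ξ η, (x ≤ X ∧ y ≤ X ∨ X ≤ x ∧ X ≤ y) →
    c / 2 * |(X - x) ^ 2 - (X - y) ^ 2| ≤ |(f x + f' x * (X - x)) - (f y + f' y * (X - y))|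

theorem hasDerivAt_of_mem_Ioo {ξ η : ℝ} {g g' : ℝ → ℝ}
    (hg : ∀ x ∈ Icc ξ η, HasDerivWithinAt g (g' x) (Icc ξ η) x) {x y : ℝ}
    (hx : x ∈ Icc ξ η) (hy : y ∈ Icc ξ η) : ∀ z ∈ Ioo x y, HasDerivAt g (g' z) z := by
  intro z hz
  have h1 : ξ < z := hx.1.trans_lt hz.1
  have h2 : z < η := hz.2.trans_le hy.2
  exact (hg z ⟨h1.le, h2.le⟩).hasDerivAt (Icc_mem_nhds h1 h2)

theorem continuousOn_of_hasDerivWithinAt {ξ η : ℝ} {g g' : ℝ → ℝ}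
    (hg : ∀ x ∈ Icc ξ η, HasDerivWithinAt g (g' x) (Icc ξ η) x) : ContinuousOn g (Icc ξ η) :=
  fun x hx => (hg x hx).continuousWithinAt

theorem exists_mean_value {ξ η : ℝ} {g g' : ℝ → ℝ}
    (hg : ∀ x ∈ Icc ξ η, HasDerivWithinAt g (g' x) (Icc ξ η) x) {x y : ℝ}
    (hx : x ∈ Icc ξ η) (hy : y ∈ Icc ξ η) (hxy : x ≤ y) :
    ∃ z ∈ Icc x y, g y - g x = g' z * (y - x) := by
  rcases hxy.eq_or_lt with rfl | hlt
  · exact ⟨x, ⟨le_rfl, le_rfl⟩, by simp⟩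
  · obtain ⟨z, hz, h⟩ := exists_hasDerivAt_eq_slope g g' hlt
      ((continuousOn_of_hasDerivWithinAt hg).mono (Icc_subset_Icc hx.1 hy.2))
      (hasDerivAt_of_mem_Ioo hg hx hy)
    refine ⟨z, Ioo_subset_Icc_self hz, ?_⟩
    have : y - x ≠ 0 := by linarith
    rw [h]; field_simp

theorem tangent_aux {ξ η c : ℝ} {f f' f'' : ℝ → ℝ}
    (hf : ∀ x ∈ Icc ξ η, HasDerivWithinAt f (f' x) (Icc ξ η) x)
    (hf' : ∀ x ∈ Icc ξ η, HasDerivWithinAt f' (f'' x) (Icc ξ η) x)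
    (hc : ∀ x ∈ Icc ξ η, c ≤ |f'' x|) {X x y : ℝ}
    (hx : x ∈ Icc ξ η) (hy : y ∈ Icc ξ η) (hxy : x < y) (hX : y ≤ X ∨ X ≤ x) :
    c / 2 * |(X - x) ^ 2 - (X - y) ^ 2| ≤
      |(f x + f' x * (X - x)) - (f y + f' y * (X - y))| := by
  have hsub : Icc x y ⊆ Icc ξ η := Icc_subset_Icc hx.1 hy.2
  have cf := (continuousOn_of_hasDerivWithinAt hf).mono hsub
  have cf' := (continuousOn_of_hasDerivWithinAt hf').mono hsub
  obtain ⟨z, hz, h⟩ := exists_ratio_hasDerivAt_eq_ratio_slope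
    (fun t => f t + f' t * (X - t)) (fun t => f'' t * (X - t)) hxy
    (by fun_prop)
    (by
      intro t ht
      have h1 := hasDerivAt_of_mem_Ioo hf hx hy t ht
      have h2 := hasDerivAt_of_mem_Ioo hf' hx hy t ht
      have h3 : HasDerivAt (fun t => X - t) (-1) t := by
        simpa using (hasDerivAt_id t).const_sub X
      exact (h1.add (h2.mul h3)).congr_deriv (by ring))
    (fun t => (X - t) ^ 2) (fun t => -2 * (X - t)) (by fun_prop)
    (by
      intro t _
      have h3 : HasDerivAt (fun t => X - t) (-1) t := by
        simpa using (hasDerivAt_id t).const_sub X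
      exact (h3.pow 2).congr_deriv (by norm_num))
  have hne : X - z ≠ 0 := by
    rcases hX with h | h
    · have := hz.2; intro h0; linarith
    · have := hz.1; intro h0; linarith
  have key : ((X - y) ^ 2 - (X - x) ^ 2) * f'' z =
      -2 * ((f y + f' y * (X - y)) - (f x + f' x * (X - x))) := by
    apply mul_right_cancel₀ hne
    linarith
  have hcz := hc z (hsub (Ioo_subset_Icc_self hz))
  have habs := congrArg abs key
  rw [abs_mul, abs_mul, abs_sub_comm ((X - y) ^ 2), abs_sub_comm (f y + _)] at habs
  norm_num at habs
  nlinarith [abs_nonneg ((X - x) ^ 2 - (X - y) ^ 2)]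

theorem exists_curvedArc {ξ η c₁ c₂ : ℝ} (hξη : ξ ≤ η) (hc₁ : 0 < c₁) {f f' f'' : ℝ → ℝ}
    (hf : ∀ x ∈ Icc ξ η, HasDerivWithinAt f (f' x) (Icc ξ η) x)
    (hf' : ∀ x ∈ Icc ξ η, HasDerivWithinAt f' (f'' x) (Icc ξ η) x)
    (hbd : ∀ x ∈ Icc ξ η, c₁ ≤ |f'' x| ∧ |f'' x| ≤ c₂) :
    ∃ c C : ℝ, CurvedArc ξ η c C f f' := by
  obtain ⟨B, hB⟩ := isCompact_Icc.exists_bound_of_continuousOn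
    (continuousOn_of_hasDerivWithinAt hf')
  have hξ : ξ ∈ Icc ξ η := ⟨le_rfl, hξη⟩
  have hB0 : 0 ≤ B := (norm_nonneg _).trans (hB ξ hξ)
  have hc₂ : 0 ≤ c₂ := (abs_nonneg _).trans (hbd ξ hξ).2
  have hcc : min c₁ 1 ≤ c₁ := min_le_left _ _
  have hlow : ∀ x ∈ Icc ξ η, ∀ y ∈ Icc ξ η, x ≤ y → min c₁ 1 * |x - y| ≤ |f' x - f' y| ∧
      |f' x - f' y| ≤ (1 + B + c₂ + (η - ξ)) * |x - y| := by
    intro x hx y hy hxy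
    obtain ⟨z, hz, h⟩ := exists_mean_value hf' hx hy hxy
    have hzI : z ∈ Icc ξ η := Icc_subset_Icc hx.1 hy.2 hz
    rw [abs_sub_comm (f' x), h, abs_mul, abs_sub_comm y x]
    exact ⟨mul_le_mul_of_nonneg_right (hcc.trans (hbd z hzI).1) (abs_nonneg _),
      mul_le_mul_of_nonneg_right (by linarith [(hbd z hzI).2]) (abs_nonneg _)⟩
  have hmin : 0 < min c₁ 1 := lt_min hc₁ one_pos
  have hlower : ∀ x ∈ Icc ξ η, ∀ y ∈ Icc ξ η, min c₁ 1 * |x - y| ≤ |f' x - f' y| := by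
    intro x hx y hy
    rcases le_total x y with h | h
    · exact (hlow x hx y hy h).1
    · rw [abs_sub_comm x, abs_sub_comm (f' x)]; exact (hlow y hy x hx h).1
  have hinj : InjOn f' (Icc ξ η) := by
    intro x hx y hy hxy
    have h := hlower x hx y hy
    rw [hxy, sub_self, abs_zero] at h
    have : |x - y| ≤ 0 := by
      by_contra! h0
      nlinarith [mul_pos hmin h0]
    linarith [abs_nonpos_iff.mp this]
  refine ⟨min c₁ 1, 1 + B + c₂ + (η - ξ), hmin, min_le_right _ _, by linarith, by linarith,
    fun x hx => (hB x hx).trans (by linarith), hlower, ?_, ?_, ?_, ?_⟩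
  · intro x hx y hy
    rcases le_total x y with h | h
    · exact (hlow x hx y hy h).2
    · rw [abs_sub_comm x, abs_sub_comm (f' x)]; exact (hlow y hy x hx h).2
  · intro x hx y hy hxy
    exact exists_mean_value hf hx hy hxy
  · intro x hx y hy z hz
    have hzI : z ∈ Icc ξ η := Icc_subset_Icc hx.1 hy.2 hz
    rw [mem_uIcc]
    rcases ContinuousOn.strictMonoOn_of_injOn_Icc' hξη
      (continuousOn_of_hasDerivWithinAt hf') hinj with h | h
    · exact Or.inl ⟨h.monotoneOn hx hzI hz.1, h.monotoneOn hzI hy hz.2⟩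
    · exact Or.inr ⟨h.antitoneOn hzI hy hz.2, h.antitoneOn hx hzI hz.1⟩
  · intro X x hx y hy hX
    have hc : ∀ x ∈ Icc ξ η, min c₁ 1 ≤ |f'' x| := fun x hx => hcc.trans (hbd x hx).1
    rcases lt_trichotomy x y with h | rfl | h
    · exact tangent_aux hf hf' hc hx hy h (by rcases hX with h | h <;> simp [h])
    · simp
    · rw [abs_sub_comm, abs_sub_comm (f x + _)]
      exact tangent_aux hf hf' hc hy hx h (by rcases hX with h | h <;> simp [h])

/-- The value at `β` of the linear form with coefficients `v` along the curve `(β, f β, 1)`. -/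
def linForm (f : ℝ → ℝ) (v : ℤ × ℤ × ℤ) (β : ℝ) : ℝ := v.1 * β + v.2.1 * f β + v.2.2

/-- The derivative of `linForm f v` at `β`. -/
def linSlope (f' : ℝ → ℝ) (v : ℤ × ℤ × ℤ) (β : ℝ) : ℝ := v.1 + v.2.1 * f' β

/-- The greatest common divisor of the entries of an integer vector. -/
def content (v : ℤ × ℤ × ℤ) : ℕ := Int.gcd (Int.gcd v.1 v.2.1) v.2.2

/-- The form `v` is small with small derivative at `β`, on the scale given by `D` and `u`. -/
def IsNear (ξ η : ℝ) (f f' : ℝ → ℝ) (D u : ℝ) (v : ℤ × ℤ × ℤ) (β : ℝ) : Prop :=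
  β ∈ Icc ξ η ∧ |linForm f v β| ≤ u ^ 2 * D ∧ |linSlope f' v β| ≤ u * D

theorem CurvedArc.exists_mean_value {ξ η c C : ℝ} {f f' : ℝ → ℝ} (hA : CurvedArc ξ η c C f f')
    (v : ℤ × ℤ × ℤ) {x y : ℝ} (hx : x ∈ Icc ξ η) (hy : y ∈ Icc ξ η) :
    ∃ z ∈ Icc ξ η, linForm f v y - linForm f v x = linSlope f' v z * (y - x) ∧
      linSlope f' v z ∈ uIcc (linSlope f' v x) (linSlope f' v y) := by
  wlog hxy : x ≤ y generalizing x y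
  · obtain ⟨z, hz, h1, h2⟩ := this hy hx (le_of_not_ge hxy)
    exact ⟨z, hz, by linarith, uIcc_comm (linSlope f' v y) _ ▸ h2⟩
  obtain ⟨z, hz, h1⟩ := hA.slope x hx y hy hxy
  have hb := hA.between x hx y hy z hz
  refine ⟨z, ⟨hx.1.trans hz.1, hz.2.trans hy.2⟩, ?_, ?_⟩
  · simp only [linForm, linSlope]
    linear_combination (v.2.1 : ℝ) * h1
  · simp only [linSlope]
    rw [mem_uIcc] at hb ⊢
    rcases le_total 0 (v.2.1 : ℝ) with h | h <;> rcases hb with ⟨h3, h4⟩ | ⟨h3, h4⟩ <;>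
      first
      | (left; constructor <;> nlinarith)
      | (right; constructor <;> nlinarith)

theorem abs_le_max_of_mem_uIcc {a b x t : ℝ} (hx : x ∈ uIcc a b) (ha : |a| ≤ t) (hb : |b| ≤ t) :
    |x| ≤ t := by
  rw [abs_le] at *
  rw [mem_uIcc] at hx
  rcases hx with h | h <;> constructor <;> linarith [h.1, h.2]

theorem CurvedArc.transport {ξ η c C : ℝ} {f f' : ℝ → ℝ} (hA : CurvedArc ξ η c C f f')
    {v : ℤ × ℤ × ℤ} {D u r β β' : ℝ} (hr : 0 ≤ r) (hd : |(v.2.1 : ℝ)| ≤ 2 * D)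
    (hv : IsNear ξ η f f' D u v β) (hβ' : β' ∈ Icc ξ η) (hββ : |β - β'| ≤ r) :
    |linSlope f' v β'| ≤ (u + 2 * C * r) * D ∧
      |linForm f v β'| ≤ (u ^ 2 + (u + 2 * C * r) * r) * D := by
  obtain ⟨hβ, hF, hS⟩ := hv
  have hD : 0 ≤ D := by linarith [abs_nonneg (v.2.1 : ℝ)]
  have hC := hA.one_le_C
  have hS' : |linSlope f' v β'| ≤ (u + 2 * C * r) * D := by
    have h1 : linSlope f' v β' = linSlope f' v β - v.2.1 * (f' β - f' β') := by
      simp only [linSlope]; ring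
    have h2 : |(v.2.1 : ℝ) * (f' β - f' β')| ≤ 2 * D * (C * r) := by
      rw [abs_mul]
      refine mul_le_mul hd ((hA.upper β hβ β' hβ').trans ?_) (abs_nonneg _) (by linarith)
      exact mul_le_mul_of_nonneg_left hββ (by linarith)
    rw [h1]
    refine (abs_sub _ _).trans ?_
    linarith
  refine ⟨hS', ?_⟩
  obtain ⟨z, -, h1, h2⟩ := hA.exists_mean_value v hβ hβ'
  have hz : |linSlope f' v z| ≤ (u + 2 * C * r) * D := by
    refine abs_le_max_of_mem_uIcc h2 (hS.trans ?_) hS'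
    have : 0 ≤ C * r := by positivity
    nlinarith [mul_nonneg this hD]
  have h3 : linForm f v β' = linForm f v β + linSlope f' v z * (β' - β) := by linarith
  have h4 : |linSlope f' v z * (β' - β)| ≤ (u + 2 * C * r) * D * r := by
    rw [abs_mul, abs_sub_comm]
    exact mul_le_mul hz hββ (abs_nonneg _) ((abs_nonneg _).trans hz)
  rw [h3]
  refine (abs_add_le _ _).trans ?_
  linarith

/-- The points at which lattice forms through a given rational point are small with small
derivative cluster on each side of that point. -/
theorem CurvedArc.close_of_same_side {ξ η c C : ℝ} {f f' : ℝ → ℝ} (hA : CurvedArc ξ η c C f f')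
    {v v' : ℤ × ℤ × ℤ} {D u X Y β β' : ℝ} (hD : 0 < D) (hu : 0 < u)
    (hd : D ≤ v.2.1) (hd' : D ≤ v'.2.1)
    (hv : IsNear ξ η f f' D u v β) (hv' : IsNear ξ η f f' D u v' β')
    (h0 : v.1 * X + v.2.1 * Y + v.2.2 = 0) (h0' : v'.1 * X + v'.2.1 * Y + v'.2.2 = 0)
    (hX : β ≤ X ∧ β' ≤ X ∨ X ≤ β ∧ X ≤ β') :
    |β - β'| ≤ 6 / c * u := by
  have hc := hA.c_pos
  have hc1 := hA.c_le_one
  have key : ∀ (v : ℤ × ℤ × ℤ) (β : ℝ), D ≤ v.2.1 → IsNear ξ η f f' D u v β →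
      v.1 * X + v.2.1 * Y + v.2.2 = 0 →
      |f β + f' β * (X - β) - Y| ≤ u ^ 2 + u * |X - β| := by
    intro v β hd hv h0
    obtain ⟨-, hF, hS⟩ := hv
    have hdp : (0 : ℝ) < v.2.1 := hD.trans_le hd
    have h1 : (v.2.1 : ℝ) * (f β + f' β * (X - β) - Y) =
        linForm f v β + linSlope f' v β * (X - β) := by
      simp only [linForm, linSlope]; linear_combination -h0
    have h2 : |(v.2.1 : ℝ) * (f β + f' β * (X - β) - Y)| ≤ (u ^ 2 + u * |X - β|) * D := by
      rw [h1]
      refine (abs_add_le _ _).trans ?_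
      rw [abs_mul]
      nlinarith [abs_nonneg (X - β)]
    rw [abs_mul, abs_of_pos hdp] at h2
    by_contra! hcon
    have h3 : 0 ≤ u ^ 2 + u * |X - β| := by positivity
    nlinarith
  have k1 := key v β hd hv h0
  have k2 := key v' β' hd' hv' h0'
  have h3 := hA.tangent X β hv.1 β' hv'.1 hX
  have h4 : |(f β + f' β * (X - β)) - (f β' + f' β' * (X - β'))| ≤
      2 * u ^ 2 + u * (|X - β| + |X - β'|) := by
    have : (f β + f' β * (X - β)) - (f β' + f' β' * (X - β')) =
      (f β + f' β * (X - β) - Y) - (f β' + f' β' * (X - β') - Y) := by ring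
    rw [this]
    refine (abs_sub _ _).trans ?_
    linarith
  have h5 : |(X - β) ^ 2 - (X - β') ^ 2| = |β - β'| * (|X - β| + |X - β'|) := by
    have : (X - β) ^ 2 - (X - β') ^ 2 = -(β - β') * ((X - β) + (X - β')) := by ring
    rw [this, abs_mul, abs_neg]
    congr 1
    rcases hX with ⟨h, h'⟩ | ⟨h, h'⟩
    · rw [abs_of_nonneg, abs_of_nonneg, abs_of_nonneg] <;> linarith
    · rw [abs_of_nonpos, abs_of_nonpos, abs_of_nonpos] <;> linarith
  have h6 : |β - β'| ≤ |X - β| + |X - β'| := by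
    have : β - β' = (X - β') - (X - β) := by ring
    rw [this]
    exact (abs_sub _ _).trans (by linarith)
  set s := |X - β| + |X - β'|
  set e := |β - β'|
  have h7 : c / 2 * (e * s) ≤ 2 * u ^ 2 + u * s := by rw [← h5]; exact h3.trans h4
  by_contra! hcon
  have h8 : 6 * u < c * e := by
    have : 6 / c * u * c = 6 * u := by field_simp
    nlinarith
  have hs : 6 * u < s := by nlinarith [abs_nonneg (β - β')]
  nlinarith [mul_pos hu (show 0 < s by linarith)]

/-- Cross product of integer vectors, for vectors ordered as slope, height, constant term; the
last entry is the denominator of the common zero of the two forms. -/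
def cross (v w : ℤ × ℤ × ℤ) : ℤ × ℤ × ℤ :=
  (v.2.1 * w.2.2 - v.2.2 * w.2.1, v.2.2 * w.1 - v.1 * w.2.2, v.1 * w.2.1 - v.2.1 * w.1)

/-- The standard bilinear form on integer vectors. -/
def pairing (v w : ℤ × ℤ × ℤ) : ℤ := v.1 * w.1 + v.2.1 * w.2.1 + v.2.2 * w.2.2

/-- The scalar multiple of an integer vector. -/
def scale (k : ℤ) (v : ℤ × ℤ × ℤ) : ℤ × ℤ × ℤ := (k * v.1, k * v.2.1, k * v.2.2)

theorem content_scale (k : ℤ) (v : ℤ × ℤ × ℤ) : content (scale k v) = k.natAbs * content v := by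
  simp only [content, scale, Int.gcd_mul_left]
  push_cast
  rw [← Int.gcd_mul_left]
  rcases abs_choice k with h | h <;> rw [h]
  rw [neg_mul, Int.neg_gcd]

theorem content_dvd (v : ℤ × ℤ × ℤ) :
    (content v : ℤ) ∣ v.1 ∧ (content v : ℤ) ∣ v.2.1 ∧ (content v : ℤ) ∣ v.2.2 := by
  have h1 : (content v : ℤ) ∣ (Int.gcd v.1 v.2.1 : ℤ) := Int.gcd_dvd_left ..
  exact ⟨h1.trans (Int.gcd_dvd_left ..), h1.trans (Int.gcd_dvd_right ..), Int.gcd_dvd_right ..⟩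

theorem content_dvd_of_dvd {v : ℤ × ℤ × ℤ} {m k : ℤ}
    (h1 : m ∣ k * v.1) (h2 : m ∣ k * v.2.1) (h3 : m ∣ k * v.2.2) : m ∣ k * content v := by
  have h : m ∣ (content (scale k v) : ℤ) := Int.dvd_coe_gcd (Int.dvd_coe_gcd h1 h2) h3
  rw [content_scale] at h
  push_cast at h
  rcases abs_choice k with h' | h' <;> rw [h'] at h
  · exact h
  · rwa [neg_mul, dvd_neg] at h

theorem exists_scale_content (v : ℤ × ℤ × ℤ) (hv : v.2.1 ≠ 0 ∨ v.2.2 ≠ 0) :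
    ∃ w, v = scale (content v) w ∧ content w = 1 ∧ 0 < content v := by
  obtain ⟨⟨a, ha⟩, ⟨d, hd⟩, ⟨n, hn⟩⟩ := content_dvd v
  have hpos : 0 < content v := by
    rcases Nat.eq_zero_or_pos (content v) with h | h
    · rw [h] at hd hn; simp at hd hn; tauto
    · exact h
  have hv' : v = scale (content v) (a, d, n) := Prod.ext ha (Prod.ext hd hn)
  refine ⟨(a, d, n), hv', ?_, hpos⟩
  have h := congrArg content hv'
  rw [content_scale, Int.natAbs_natCast] at h
  exact Nat.eq_of_mul_eq_mul_left hpos (by omega)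

theorem exists_primitive_pos (v : ℤ × ℤ × ℤ) (hv : v.2.2 ≠ 0) :
    ∃ (g : ℤ) (w : ℤ × ℤ × ℤ), g ≠ 0 ∧ v = scale g w ∧ content w = 1 ∧ 0 < w.2.2 := by
  obtain ⟨w, h, hc, hpos⟩ := exists_scale_content v (Or.inr hv)
  have hw : w.2.2 ≠ 0 := by
    intro h0; rw [h] at hv; simp [scale, h0] at hv
  rcases lt_or_gt_of_ne hw with hw | hw
  · refine ⟨-(content v : ℤ), scale (-1) w, by omega, ?_, by rw [content_scale, hc]; rfl, ?_⟩
    · conv_lhs => rw [h]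
      simp [scale]
    · simpa [scale] using hw
  · exact ⟨content v, w, by omega, h, hc, hw⟩

theorem dvd_cross_of_pairing_eq_zero {v v' w : ℤ × ℤ × ℤ} (hw : content w = 1)
    (h : pairing v w = 0) (h' : pairing v' w = 0) : w.2.2 ∣ (cross v v').2.2 := by
  have := content_dvd_of_dvd (v := w) (m := w.2.2) (k := (cross v v').2.2)
    ⟨(cross v v').1, by simp only [cross, pairing] at *; linear_combination v'.2.1 * h - v.2.1 * h'⟩
    ⟨(cross v v').2.1, by simp only [cross, pairing] at *; linear_combination v.1 * h' - v'.1 * h⟩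
    ⟨(cross v v').2.2, by ring⟩
  simpa [hw] using this

theorem eq_of_cross_eq_zero {v v' : ℤ × ℤ × ℤ} (hv : content v = 1) (hv' : content v' = 1)
    (hd : 0 < v.2.1) (hd' : 0 < v'.2.1) (h1 : (cross v v').1 = 0) (h2 : (cross v v').2.2 = 0) :
    v = v' := by
  simp only [cross] at h1 h2
  have h : scale v'.2.1 v = scale v.2.1 v' := by
    simp only [scale, Prod.mk.injEq]
    exact ⟨by linarith, by ring, by linarith⟩
  have hc := congrArg content h
  rw [content_scale, content_scale, hv, hv'] at hc
  have hdd : v.2.1 = v'.2.1 := by omega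
  simp only [scale, Prod.mk.injEq, hdd] at h
  exact Prod.ext (mul_left_cancel₀ hd'.ne' h.1)
    (Prod.ext hdd (mul_left_cancel₀ hd'.ne' h.2.2))

theorem cross_fst_sub (f : ℝ → ℝ) (v v' : ℤ × ℤ × ℤ) (β : ℝ) :
    ((cross v v').1 : ℝ) - (cross v v').2.2 * β =
      v.2.1 * linForm f v' β - v'.2.1 * linForm f v β := by
  simp only [cross, linForm]; push_cast; ring

theorem cross_snd_sub (f : ℝ → ℝ) (v v' : ℤ × ℤ × ℤ) (β : ℝ) :
    ((cross v v').2.1 : ℝ) - (cross v v').2.2 * f β =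
      v'.1 * linForm f v β - v.1 * linForm f v' β := by
  simp only [cross, linForm]; push_cast; ring

theorem cross_denom (f' : ℝ → ℝ) (v v' : ℤ × ℤ × ℤ) (β : ℝ) :
    ((cross v v').2.2 : ℝ) = v'.2.1 * linSlope f' v β - v.2.1 * linSlope f' v' β := by
  simp only [cross, linSlope]; push_cast; ring

theorem pairing_cross (f f' : ℝ → ℝ) (v₁ v₂ v₃ : ℤ × ℤ × ℤ) (β : ℝ) :
    (pairing v₁ (cross v₂ v₃) : ℝ) =
      linSlope f' v₁ β * (v₂.2.1 * linForm f v₃ β - v₃.2.1 * linForm f v₂ β) +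
      linSlope f' v₂ β * (v₃.2.1 * linForm f v₁ β - v₁.2.1 * linForm f v₃ β) +
      linSlope f' v₃ β * (v₁.2.1 * linForm f v₂ β - v₂.2.1 * linForm f v₁ β) := by
  simp only [cross, pairing, linForm, linSlope]; push_cast; ring

theorem card_le_of_separated {α : Type*} (s : Finset α) (x : α → ℝ) {σ L : ℝ} (hσ : 0 < σ)
    (hL : ∀ a ∈ s, ∀ b ∈ s, x a - x b ≤ L)
    (hs : ∀ a ∈ s, ∀ b ∈ s, a ≠ b → σ ≤ |x a - x b|) : s.card ≤ ⌊L / σ⌋₊ + 1 := by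
  rcases s.eq_empty_or_nonempty with rfl | hne
  · simp
  obtain ⟨a₀, ha₀, hmin⟩ := s.exists_min_image x hne
  rw [← Finset.card_range (⌊L / σ⌋₊ + 1)]
  refine Finset.card_le_card_of_injOn (fun a => ⌊(x a - x a₀) / σ⌋₊) ?_ ?_
  · intro a ha
    simp only [Finset.coe_range, mem_Iio]
    exact Nat.lt_succ_of_le (Nat.floor_le_floor (div_le_div_of_nonneg_right (hL a ha a₀ ha₀) hσ.le))
  · intro a ha b hb hab
    by_contra hne
    have h := hs a ha b hb hne
    have ha' : 0 ≤ (x a - x a₀) / σ := div_nonneg (by linarith [hmin a ha]) hσ.le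
    have hb' : 0 ≤ (x b - x a₀) / σ := div_nonneg (by linarith [hmin b hb]) hσ.le
    have h1 := Nat.floor_le ha'
    have h2 := Nat.lt_floor_add_one ((x a - x a₀) / σ)
    have h3 := Nat.floor_le hb'
    have h4 := Nat.lt_floor_add_one ((x b - x a₀) / σ)
    simp only at hab
    rw [hab] at h1 h2
    have h5 : |(x a - x a₀) / σ - (x b - x a₀) / σ| < 1 := by
      rw [abs_lt]; constructor <;> linarith
    rw [← sub_div, abs_div, abs_of_pos hσ, div_lt_one hσ, sub_sub_sub_cancel_right] at h5
    linarith

theorem card_le_of_separated_real {α : Type*} (s : Finset α) (x : α → ℝ) {σ L : ℝ} (hσ : 0 < σ)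
    (hL0 : 0 ≤ L) (hL : ∀ a ∈ s, ∀ b ∈ s, x a - x b ≤ L)
    (hs : ∀ a ∈ s, ∀ b ∈ s, a ≠ b → σ ≤ |x a - x b|) : (s.card : ℝ) ≤ L / σ + 1 := by
  have h := card_le_of_separated s x hσ hL hs
  have h' : (s.card : ℝ) ≤ (⌊L / σ⌋₊ : ℝ) + 1 := by exact_mod_cast h
  linarith [Nat.floor_le (div_nonneg hL0 hσ.le)]

theorem card_int_le {s : Finset ℤ} {L : ℝ} (hL0 : 0 ≤ L)
    (hL : ∀ a ∈ s, ∀ b ∈ s, (a : ℝ) - b ≤ L) : (s.card : ℝ) ≤ L + 1 := by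
  have := card_le_of_separated_real s (fun a => (a : ℝ)) one_pos hL0 hL (fun a _ b _ hab => by
    have : 1 ≤ |a - b| := Int.one_le_abs (sub_ne_zero.mpr hab)
    exact_mod_cast this)
  simpa using this

theorem card_le_mul_of_fiber {α β : Type*} [DecidableEq β] (s : Finset α) (g : α → β) {M N : ℝ}
    (hM : 0 ≤ M) (hN : ((s.image g).card : ℝ) ≤ N)
    (hfib : ∀ b ∈ s.image g, ((s.filter (fun a => g a = b)).card : ℝ) ≤ M) :
    (s.card : ℝ) ≤ M * N := by
  rw [Finset.card_eq_sum_card_image g s]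
  push_cast
  refine (Finset.sum_le_sum hfib).trans ?_
  rw [Finset.sum_const, nsmul_eq_mul, mul_comm]
  exact mul_le_mul_of_nonneg_left hN hM

/-- The constant controlling the geometry of nearly tangent forms. -/
noncomputable def arcConst (c C : ℝ) : ℝ := (1 + 2 * C * (6 / c)) * (1 + 6 / c)

theorem CurvedArc.arcConst_ge {ξ η c C : ℝ} {f f' : ℝ → ℝ} (hA : CurvedArc ξ η c C f f') :
    1 + 6 / c ≤ arcConst c C ∧ 1 + 2 * C * (6 / c) ≤ arcConst c C ∧ 6 ≤ 6 / c ∧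
      2 + 2 * C ≤ arcConst c C ∧ 1 ≤ arcConst c C := by
  have hc := hA.c_pos
  have hC := hA.one_le_C
  have h6 : 6 ≤ 6 / c := by rw [le_div_iff₀ hc]; linarith [hA.c_le_one]
  have : 0 ≤ C * (6 / c) := by positivity
  have h7 : C * 6 ≤ C * (6 / c) := mul_le_mul_of_nonneg_left h6 (by linarith)
  unfold arcConst
  refine ⟨by nlinarith, by nlinarith, h6, by nlinarith, by nlinarith⟩

set_option maxHeartbeats 1000000 in
/-- Two distinct primitive forms that are nearly tangent at neighbouring points determine a
rational point of small denominator close to the curve, and every form coplanar with them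
vanishes there. -/
theorem CurvedArc.exists_normal_of_pair {ξ η c C : ℝ} {f f' : ℝ → ℝ}
    (hA : CurvedArc ξ η c C f f') {κ D u : ℝ} (hκ : 0 < κ) (hκ1 : 100 * arcConst c C ^ 2 * κ ≤ 1)
    (hD : 1 ≤ D) (hu : 0 < u) (huκ : u * D ≤ κ) {v v' : ℤ × ℤ × ℤ} {β β' : ℝ}
    (hc : content v = 1) (hc' : content v' = 1) (hd : D ≤ v.2.1 ∧ (v.2.1 : ℝ) ≤ 2 * D)
    (hd' : D ≤ v'.2.1 ∧ (v'.2.1 : ℝ) ≤ 2 * D) (hv : IsNear ξ η f f' D u v β)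
    (hv' : IsNear ξ η f f' D u v' β') (hne : v ≠ v') :
    (cross v v').2.2 ≠ 0 ∧ (|β - β'| ≤ 6 / c * u →
    ∃ w : ℤ × ℤ × ℤ, content w = 1 ∧ 0 < w.2.2 ∧ (w.2.2 : ℝ) ≤ 4 * arcConst c C * u * D ^ 2 ∧
      (∃ z ∈ Icc ξ η, |(w.1 : ℝ) - w.2.2 * z| ≤ 6 * arcConst c C ^ 2 ∧
        |(w.2.1 : ℝ) - w.2.2 * f z| ≤ 6 * arcConst c C ^ 2) ∧
      ∀ v'', pairing v'' (cross v v') = 0 → pairing v'' w = 0) := by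
  obtain ⟨hA1, hA2, h6, hA3, hA4⟩ := hA.arcConst_ge
  have hcp := hA.c_pos
  have hC := hA.one_le_C
  set A := arcConst c C with hAdef
  have hκ1' : κ ≤ 1 := by nlinarith
  have hAκ : A ^ 2 * (u * D) ≤ 1 / 100 := by nlinarith [sq_nonneg A]
  have huD0 : 0 < u * D := by positivity
  have huD1 : u * D ≤ 1 := huκ.trans hκ1'
  have huD2 : u ^ 2 * D ^ 2 ≤ u * D := by nlinarith
  have hd0 : 0 < v.2.1 := by exact_mod_cast (show (0 : ℝ) < v.2.1 by linarith)
  have hd0' : 0 < v'.2.1 := by exact_mod_cast (show (0 : ℝ) < v'.2.1 by linarith)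
  have key : |β - β'| ≤ 6 / c * u →
      |linForm f v β| ≤ A * u ^ 2 * D ∧ |linForm f v' β| ≤ A * u ^ 2 * D ∧
      |linSlope f' v β| ≤ A * u * D ∧ |linSlope f' v' β| ≤ A * u * D := by
    intro h
    obtain ⟨h1, h2⟩ := hA.transport (r := 6 / c * u) (by positivity)
      (by rw [abs_of_nonneg (by linarith)]; exact hd'.2) hv' hv.1 (by rwa [abs_sub_comm])
    have hu2 : 0 ≤ u ^ 2 * D := by positivity
    refine ⟨hv.2.1.trans (by nlinarith), h2.trans ?_, hv.2.2.trans (by nlinarith), h1.trans ?_⟩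
    · have : u ^ 2 + (u + 2 * C * (6 / c * u)) * (6 / c * u) ≤ A * u ^ 2 := by
        rw [hAdef, arcConst]
        nlinarith [mul_nonneg (show 0 ≤ 2 * C * (6 / c) by positivity) (sq_nonneg u)]
      exact mul_le_mul_of_nonneg_right this (by linarith)
    · have : u + 2 * C * (6 / c * u) ≤ A * u := by nlinarith
      exact mul_le_mul_of_nonneg_right this (by linarith)
  have hfst : |β - β'| ≤ 6 / c * u →
      |((cross v v').1 : ℝ) - (cross v v').2.2 * β| ≤ 4 * A * (u ^ 2 * D ^ 2) := by
    intro h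
    obtain ⟨k1, k2, -, -⟩ := key h
    rw [cross_fst_sub f]
    refine (abs_sub _ _).trans ?_
    rw [abs_mul, abs_mul, abs_of_nonneg (show (0 : ℝ) ≤ v.2.1 by linarith),
      abs_of_nonneg (show (0 : ℝ) ≤ v'.2.1 by linarith)]
    have e1 : (v.2.1 : ℝ) * |linForm f v' β| ≤ 2 * D * (A * u ^ 2 * D) :=
      mul_le_mul hd.2 k2 (abs_nonneg _) (by linarith)
    have e2 : (v'.2.1 : ℝ) * |linForm f v β| ≤ 2 * D * (A * u ^ 2 * D) :=
      mul_le_mul hd'.2 k1 (abs_nonneg _) (by linarith)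
    linarith
  have hAA : A ≤ A ^ 2 := by nlinarith
  have hcross : (cross v v').2.2 ≠ 0 := by
    intro h0
    have hclose : |β - β'| ≤ 6 / c * u := by
      have e := cross_denom f' v v' β
      rw [h0] at e
      have e3 : (v.2.1 : ℝ) * v'.2.1 * (f' β - f' β') =
          v'.2.1 * linSlope f' v β - v.2.1 * linSlope f' v' β' := by
        have h0' := congrArg (Int.cast : ℤ → ℝ) h0
        simp only [cross] at h0'
        push_cast at h0'
        simp only [linSlope]
        linear_combination -h0'
      have e4 : (v.2.1 : ℝ) * v'.2.1 * |f' β - f' β'| ≤ v'.2.1 * (u * D) + v.2.1 * (u * D) := by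
        have := congrArg abs e3
        rw [abs_mul, abs_mul, abs_of_nonneg (show (0 : ℝ) ≤ v.2.1 by linarith),
          abs_of_nonneg (show (0 : ℝ) ≤ v'.2.1 by linarith)] at this
        rw [this]
        refine (abs_sub _ _).trans ?_
        rw [abs_mul, abs_mul, abs_of_nonneg (show (0 : ℝ) ≤ v.2.1 by linarith),
          abs_of_nonneg (show (0 : ℝ) ≤ v'.2.1 by linarith)]
        exact add_le_add (mul_le_mul_of_nonneg_left hv.2.2 (by linarith))
          (mul_le_mul_of_nonneg_left hv'.2.2 (by linarith))
      have e5 : |f' β - f' β'| ≤ 2 * u := by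
        by_contra! hcon
        have p1 : (v.2.1 : ℝ) * v'.2.1 * (2 * u) < (v.2.1 : ℝ) * v'.2.1 * |f' β - f' β'| :=
          mul_lt_mul_of_pos_left hcon (mul_pos (by linarith) (by linarith))
        nlinarith [mul_nonneg (mul_nonneg (show (0 : ℝ) ≤ v'.2.1 by linarith) hu.le)
            (show (0 : ℝ) ≤ v.2.1 - D by linarith),
          mul_nonneg (mul_nonneg (show (0 : ℝ) ≤ v.2.1 by linarith) hu.le)
            (show (0 : ℝ) ≤ v'.2.1 - D by linarith)]
      have e6 := hA.lower β hv.1 β' hv'.1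
      rw [div_mul_eq_mul_div, le_div_iff₀ hcp]
      linarith
    have h1 := hfst hclose
    rw [h0, Int.cast_zero, zero_mul, sub_zero] at h1
    have h2 : |((cross v v').1 : ℝ)| < 1 := by nlinarith
    have h3 : (cross v v').1 = 0 := Int.abs_lt_one_iff.mp (by exact_mod_cast h2)
    exact hne (eq_of_cross_eq_zero hc hc' hd0 hd0' h3 h0)
  refine ⟨hcross, fun hclose => ?_⟩
  obtain ⟨k1, k2, k3, k4⟩ := key hclose
  obtain ⟨g, w, hg, hw, hcw, hpos⟩ := exists_primitive_pos _ hcross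
  have hg1 : (1 : ℝ) ≤ |(g : ℝ)| := by exact_mod_cast Int.one_le_abs hg
  have hred : ∀ {x y B : ℝ}, |x| ≤ B → x = g * y → |y| ≤ B := by
    intro x y B hx hxy
    rw [hxy, abs_mul] at hx
    nlinarith [abs_nonneg y]
  have e1 : (cross v v').1 = g * w.1 := by rw [hw]; rfl
  have e2 : (cross v v').2.1 = g * w.2.1 := by rw [hw]; rfl
  have e3 : (cross v v').2.2 = g * w.2.2 := by rw [hw]; rfl
  have hslope : ∀ v : ℤ × ℤ × ℤ, D ≤ v.2.1 ∧ (v.2.1 : ℝ) ≤ 2 * D →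
      |linSlope f' v β| ≤ A * u * D → |(v.1 : ℝ)| ≤ 3 * A * D := by
    intro v hd h
    have : (v.1 : ℝ) = linSlope f' v β - v.2.1 * f' β := by simp only [linSlope]; ring
    rw [this]
    refine (abs_sub _ _).trans ?_
    rw [abs_mul, abs_of_nonneg (show (0 : ℝ) ≤ v.2.1 by linarith)]
    have : (v.2.1 : ℝ) * |f' β| ≤ 2 * D * C :=
      mul_le_mul hd.2 (hA.abs_deriv_le β hv.1) (abs_nonneg _) (by linarith)
    have t1 : A * (u * D) ≤ A * 1 := mul_le_mul_of_nonneg_left huD1 (by linarith)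
    have t2 : A * 1 ≤ A * D := mul_le_mul_of_nonneg_left hD (by linarith)
    have t3 : (2 + 2 * C) * D ≤ A * D := mul_le_mul_of_nonneg_right hA3 (by linarith)
    linarith
  refine ⟨w, hcw, hpos, ?_, ⟨β, hv.1, ?_, ?_⟩, ?_⟩
  · have h1 : |((cross v v').2.2 : ℝ)| ≤ 4 * A * u * D ^ 2 := by
      rw [cross_denom f' v v' β]
      refine (abs_sub _ _).trans ?_
      rw [abs_mul, abs_mul, abs_of_nonneg (show (0 : ℝ) ≤ v.2.1 by linarith),
        abs_of_nonneg (show (0 : ℝ) ≤ v'.2.1 by linarith)]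
      have e1 : (v.2.1 : ℝ) * |linSlope f' v' β| ≤ 2 * D * (A * u * D) :=
        mul_le_mul hd.2 k4 (abs_nonneg _) (by linarith)
      have e2 : (v'.2.1 : ℝ) * |linSlope f' v β| ≤ 2 * D * (A * u * D) :=
        mul_le_mul hd'.2 k3 (abs_nonneg _) (by linarith)
      linarith
    exact (le_abs_self _).trans (hred h1 (by exact_mod_cast e3))
  · refine hred ((hfst hclose).trans ?_) (y := (w.1 : ℝ) - w.2.2 * β) ?_
    · nlinarith
    · rw [e1, e3]; push_cast; ring
  · refine hred (x := ((cross v v').2.1 : ℝ) - (cross v v').2.2 * f β) ?_ ?_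
    · rw [cross_snd_sub]
      refine (abs_sub _ _).trans ?_
      rw [abs_mul, abs_mul]
      have e1 : |(v'.1 : ℝ)| * |linForm f v β| ≤ 3 * A * D * (A * u ^ 2 * D) :=
        mul_le_mul (hslope v' hd' k4) k1 (abs_nonneg _) (by positivity)
      have e2 : |(v.1 : ℝ)| * |linForm f v' β| ≤ 3 * A * D * (A * u ^ 2 * D) :=
        mul_le_mul (hslope v hd k3) k2 (abs_nonneg _) (by positivity)
      have e3 : A ^ 2 * (u ^ 2 * D ^ 2) ≤ A ^ 2 * 1 :=
        mul_le_mul_of_nonneg_left (by linarith) (sq_nonneg A)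
      linarith
    · rw [e2, e3]; push_cast; ring
  · intro v'' h
    have : g * pairing v'' w = 0 := by
      rw [hw] at h
      simp only [pairing, scale] at h ⊢
      linarith
    exact (mul_eq_zero.mp this).resolve_left hg

theorem CurvedArc.pairing_cross_eq_zero {ξ η c C : ℝ} {f f' : ℝ → ℝ}
    (hA : CurvedArc ξ η c C f f') {κ D u : ℝ} (hκ : 0 < κ) (hκ1 : 100 * arcConst c C ^ 2 * κ ≤ 1)
    (hD : 1 ≤ D) (hu : 0 < u) (huκ : u * D ≤ κ) {v₁ v₂ v₃ : ℤ × ℤ × ℤ} {β₁ β₂ β₃ : ℝ}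
    (hd₁ : D ≤ v₁.2.1 ∧ (v₁.2.1 : ℝ) ≤ 2 * D) (hd₂ : D ≤ v₂.2.1 ∧ (v₂.2.1 : ℝ) ≤ 2 * D)
    (hd₃ : D ≤ v₃.2.1 ∧ (v₃.2.1 : ℝ) ≤ 2 * D) (hv₁ : IsNear ξ η f f' D u v₁ β₁)
    (hv₂ : IsNear ξ η f f' D u v₂ β₂) (hv₃ : IsNear ξ η f f' D u v₃ β₃)
    (h₂ : |β₂ - β₁| ≤ κ / D) (h₃ : |β₃ - β₁| ≤ κ / D) : pairing v₁ (cross v₂ v₃) = 0 := by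
  obtain ⟨-, -, -, hA3, hA4⟩ := hA.arcConst_ge
  have hC := hA.one_le_C
  set A := arcConst c C with hAdef
  have hκ1' : κ ≤ 1 := by nlinarith
  have key : ∀ (v : ℤ × ℤ × ℤ) (β : ℝ), D ≤ v.2.1 ∧ (v.2.1 : ℝ) ≤ 2 * D →
      IsNear ξ η f f' D u v β → |β - β₁| ≤ κ / D →
      |linSlope f' v β₁| ≤ A * κ ∧ |(v.2.1 : ℝ)| ≤ 2 * D ∧ |linForm f v β₁| ≤ A * κ ^ 2 / D := by
    intro v β hd hv h
    have hd' : |(v.2.1 : ℝ)| ≤ 2 * D := by rw [abs_of_nonneg (by linarith)]; exact hd.2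
    obtain ⟨e1, e2⟩ := hA.transport (by positivity) hd' hv hv₁.1 h
    refine ⟨e1.trans ?_, hd', e2.trans ?_⟩
    · have : (u + 2 * C * (κ / D)) * D = u * D + 2 * C * κ := by field_simp
      rw [this]
      nlinarith
    · have : (u ^ 2 + (u + 2 * C * (κ / D)) * (κ / D)) * D =
        ((u * D) ^ 2 + (u * D + 2 * C * κ) * κ) / D := by field_simp
      rw [this]
      apply div_le_div_of_nonneg_right _ (by linarith)
      have t1 : (u * D) ^ 2 ≤ κ ^ 2 := pow_le_pow_left₀ (by positivity) huκ 2
      have t2 : u * D * κ ≤ κ * κ := mul_le_mul_of_nonneg_right huκ hκ.le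
      have t3 : (2 + 2 * C) * κ ^ 2 ≤ A * κ ^ 2 := mul_le_mul_of_nonneg_right hA3 (sq_nonneg κ)
      linarith
  obtain ⟨s1, d1, f1⟩ := key v₁ β₁ hd₁ hv₁ (by simp; positivity)
  obtain ⟨s2, d2, f2⟩ := key v₂ β₂ hd₂ hv₂ h₂
  obtain ⟨s3, d3, f3⟩ := key v₃ β₃ hd₃ hv₃ h₃
  have hterm : ∀ {s d e d' e' : ℝ}, |s| ≤ A * κ → |d| ≤ 2 * D → |e| ≤ A * κ ^ 2 / D →
      |d'| ≤ 2 * D → |e'| ≤ A * κ ^ 2 / D → |s * (d * e - d' * e')| ≤ 4 * A ^ 2 * κ ^ 3 := by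
    intro s d e d' e' hs hd he hd' he'
    rw [abs_mul]
    have t1 : |d * e - d' * e'| ≤ 4 * A * κ ^ 2 := by
      refine (abs_sub _ _).trans ?_
      rw [abs_mul, abs_mul]
      have r1 : |d| * |e| ≤ 2 * D * (A * κ ^ 2 / D) :=
        mul_le_mul hd he (abs_nonneg _) (by linarith)
      have r2 : |d'| * |e'| ≤ 2 * D * (A * κ ^ 2 / D) :=
        mul_le_mul hd' he' (abs_nonneg _) (by linarith)
      have r3 : 2 * D * (A * κ ^ 2 / D) = 2 * A * κ ^ 2 := by field_simp
      linarith
    calc |s| * |d * e - d' * e'| ≤ (A * κ) * (4 * A * κ ^ 2) :=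
          mul_le_mul hs t1 (abs_nonneg _) (by positivity)
      _ = _ := by ring
  have hlt : |(pairing v₁ (cross v₂ v₃) : ℝ)| < 1 := by
    rw [pairing_cross f f' v₁ v₂ v₃ β₁]
    refine (abs_add_three _ _ _).trans_lt ?_
    have t1 := hterm s1 d2 f3 d3 f2
    have t2 := hterm s2 d3 f1 d1 f3
    have t3 := hterm s3 d1 f2 d2 f1
    have t4 : A ^ 2 * κ * κ ^ 2 ≤ A ^ 2 * κ * 1 :=
      mul_le_mul_of_nonneg_left (by nlinarith) (by positivity)
    nlinarith
  exact Int.abs_lt_one_iff.mp (by exact_mod_cast hlt)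

/-- A primitive integer vector whose rational point lies close to the curve. -/
def IsCloseRational (ξ η c C : ℝ) (f : ℝ → ℝ) (D u : ℝ) (w : ℤ × ℤ × ℤ) : Prop :=
  content w = 1 ∧ 0 < w.2.2 ∧ (w.2.2 : ℝ) ≤ 4 * arcConst c C * u * D ^ 2 ∧
    ∃ z ∈ Icc ξ η, |(w.1 : ℝ) - w.2.2 * z| ≤ 6 * arcConst c C ^ 2 ∧
      |(w.2.1 : ℝ) - w.2.2 * f z| ≤ 6 * arcConst c C ^ 2

theorem zero_of_pairing_eq_zero {v w : ℤ × ℤ × ℤ} (hw : w.2.2 ≠ 0) (h : pairing v w = 0) :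
    (v.1 : ℝ) * (w.1 / w.2.2) + v.2.1 * (w.2.1 / w.2.2) + v.2.2 = 0 := by
  have hw' : (w.2.2 : ℝ) ≠ 0 := by exact_mod_cast hw
  have h' : (v.1 : ℝ) * w.1 + v.2.1 * w.2.1 + v.2.2 * w.2.2 = 0 := by
    have := congrArg (Int.cast : ℤ → ℝ) h
    simp only [pairing] at this
    exact_mod_cast this
  field_simp
  linarith

theorem pairing_cross_perm (a b d : ℤ × ℤ × ℤ) :
    pairing a (cross a b) = 0 ∧ pairing b (cross a b) = 0 ∧
      pairing a (cross b d) = pairing d (cross a b) ∧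
      pairing a (cross b d) = - pairing b (cross a d) := by
  simp only [pairing, cross]
  refine ⟨by ring, by ring, by ring, by ring⟩

theorem CurvedArc.exists_normal_of_triple {ξ η c C : ℝ} {f f' : ℝ → ℝ}
    (hA : CurvedArc ξ η c C f f') {κ D u : ℝ} (hκ : 0 < κ) (hκ1 : 100 * arcConst c C ^ 2 * κ ≤ 1)
    (hD : 1 ≤ D) (hu : 0 < u) (huκ : u * D ≤ κ) {v₁ v₂ v₃ : ℤ × ℤ × ℤ} {β₁ β₂ β₃ : ℝ}
    (hc₁ : content v₁ = 1) (hc₂ : content v₂ = 1) (hc₃ : content v₃ = 1)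
    (hd₁ : D ≤ v₁.2.1 ∧ (v₁.2.1 : ℝ) ≤ 2 * D) (hd₂ : D ≤ v₂.2.1 ∧ (v₂.2.1 : ℝ) ≤ 2 * D)
    (hd₃ : D ≤ v₃.2.1 ∧ (v₃.2.1 : ℝ) ≤ 2 * D) (hv₁ : IsNear ξ η f f' D u v₁ β₁)
    (hv₂ : IsNear ξ η f f' D u v₂ β₂) (hv₃ : IsNear ξ η f f' D u v₃ β₃)
    (h₂ : |β₂ - β₁| ≤ κ / D) (h₃ : |β₃ - β₁| ≤ κ / D)
    (h12 : v₁ ≠ v₂) (h13 : v₁ ≠ v₃) (h23 : v₂ ≠ v₃) :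
    ∃ w, IsCloseRational ξ η c C f D u w ∧ pairing v₁ w = 0 := by
  have hD0 : 0 < D := by linarith
  have hdet := hA.pairing_cross_eq_zero hκ hκ1 hD hu huκ hd₁ hd₂ hd₃ hv₁ hv₂ hv₃ h₂ h₃
  obtain ⟨p1, p2, p3, p4⟩ := pairing_cross_perm v₁ v₂ v₃
  obtain ⟨q1, q2, -, -⟩ := pairing_cross_perm v₁ v₃ v₂
  obtain ⟨n12, c12⟩ := hA.exists_normal_of_pair hκ hκ1 hD hu huκ hc₁ hc₂ hd₁ hd₂ hv₁ hv₂ h12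
  obtain ⟨-, c13⟩ := hA.exists_normal_of_pair hκ hκ1 hD hu huκ hc₁ hc₃ hd₁ hd₃ hv₁ hv₃ h13
  obtain ⟨-, c23⟩ := hA.exists_normal_of_pair hκ hκ1 hD hu huκ hc₂ hc₃ hd₂ hd₃ hv₂ hv₃ h23
  have z1 := zero_of_pairing_eq_zero n12 p1
  have z2 := zero_of_pairing_eq_zero n12 p2
  have z3 := zero_of_pairing_eq_zero n12 (p3 ▸ hdet)
  set X : ℝ := ((cross v₁ v₂).1 : ℝ) / (cross v₁ v₂).2.2
  have r12 := hA.close_of_same_side hD0 hu hd₁.1 hd₂.1 hv₁ hv₂ z1 z2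
  have r13 := hA.close_of_same_side hD0 hu hd₁.1 hd₃.1 hv₁ hv₃ z1 z3
  have r23 := hA.close_of_same_side hD0 hu hd₂.1 hd₃.1 hv₂ hv₃ z2 z3
  have hsides : (β₁ ≤ X ∧ β₂ ≤ X ∨ X ≤ β₁ ∧ X ≤ β₂) ∨ (β₁ ≤ X ∧ β₃ ≤ X ∨ X ≤ β₁ ∧ X ≤ β₃) ∨
      (β₂ ≤ X ∧ β₃ ≤ X ∨ X ≤ β₂ ∧ X ≤ β₃) := by
    rcases le_total β₁ X with h1 | h1 <;> rcases le_total β₂ X with h2 | h2 <;>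
      rcases le_total β₃ X with h3 | h3 <;> simp [h1, h2, h3]
  rcases hsides with h | h | h
  · obtain ⟨w, a1, a2, a3, a4, a5⟩ := c12 (r12 h)
    exact ⟨w, ⟨a1, a2, a3, a4⟩, a5 _ p1⟩
  · obtain ⟨w, a1, a2, a3, a4, a5⟩ := c13 (r13 h)
    exact ⟨w, ⟨a1, a2, a3, a4⟩, a5 _ q1⟩
  · obtain ⟨w, a1, a2, a3, a4, a5⟩ := c23 (r23 h)
    exact ⟨w, ⟨a1, a2, a3, a4⟩, a5 _ hdet⟩

/-- A primitive form with leading coefficient of size `D` that is nearly tangent somewhere. -/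
def IsNearPrimitive (ξ η : ℝ) (f f' : ℝ → ℝ) (D u : ℝ) (v : ℤ × ℤ × ℤ) : Prop :=
  content v = 1 ∧ (D ≤ v.2.1 ∧ (v.2.1 : ℝ) ≤ 2 * D) ∧ ∃ β, IsNear ξ η f f' D u v β

theorem CurvedArc.card_pairing_eq_zero_le {ξ η c C : ℝ} {f f' : ℝ → ℝ}
    (hA : CurvedArc ξ η c C f f') {D u : ℝ} (hD : 1 ≤ D) (hu : 0 < u)
    {w : ℤ × ℤ × ℤ} (hw : IsCloseRational ξ η c C f D u w)
    (V : Finset (ℤ × ℤ × ℤ)) (hV : ∀ v ∈ V, IsNearPrimitive ξ η f f' D u v)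
    (hVw : ∀ v ∈ V, pairing v w = 0) :
    (V.card : ℝ) ≤ 32 * arcConst c C * (u * D ^ 2) / w.2.2 := by
  obtain ⟨-, hA2, h6, hA3, hA4⟩ := hA.arcConst_ge
  have hC := hA.one_le_C
  have hc0 := hA.c_pos
  set A := arcConst c C with hAdef
  obtain ⟨hcw, hh, hhu, -⟩ := hw
  have hh0 : (0 : ℝ) < w.2.2 := by exact_mod_cast hh
  have hD0 : 0 < D := by linarith
  choose! b hb using fun v hv => (hV v hv).2.2
  set X : ℝ := (w.1 : ℝ) / w.2.2
  have side : ∀ S ⊆ V, (∀ v ∈ S, ∀ v' ∈ S, b v ≤ X ∧ b v' ≤ X ∨ X ≤ b v ∧ X ≤ b v') →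
      (S.card : ℝ) ≤ 16 * A * (u * D ^ 2) / w.2.2 := by
    intro S hSV hS
    have hσ : (0 : ℝ) < w.2.2 / (4 * D ^ 2) := by positivity
    have := card_le_of_separated_real S (fun v => (v.1 : ℝ) / v.2.1) hσ
      (L := 3 * A * u) (by positivity) ?_ ?_
    · have e1 : 3 * A * u / (w.2.2 / (4 * D ^ 2)) = 12 * A * (u * D ^ 2) / w.2.2 := by
        field_simp; ring
      have e2 : 1 ≤ 4 * A * (u * D ^ 2) / w.2.2 := by rw [le_div_iff₀ hh0]; linarith
      rw [e1] at this
      have e3 : 16 * A * (u * D ^ 2) / w.2.2 = 12 * A * (u * D ^ 2) / w.2.2 +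
        4 * A * (u * D ^ 2) / w.2.2 := by ring
      linarith
    · intro v hv v' hv'
      have close := hA.close_of_same_side hD0 hu (hV v (hSV hv)).2.1.1 (hV v' (hSV hv')).2.1.1
        (hb v (hSV hv)) (hb v' (hSV hv')) (zero_of_pairing_eq_zero hh.ne' (hVw v (hSV hv)))
        (zero_of_pairing_eq_zero hh.ne' (hVw v' (hSV hv'))) (hS v hv v' hv')
      have key : ∀ v ∈ V, |(v.1 : ℝ) / v.2.1 + f' (b v)| ≤ u := by
        intro v hv
        have hd := (hV v hv).2.1.1
        have hd0 : (0 : ℝ) < v.2.1 := by linarith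
        have : (v.1 : ℝ) / v.2.1 + f' (b v) = linSlope f' v (b v) / v.2.1 := by
          simp only [linSlope]; field_simp
        rw [this, abs_div, abs_of_pos hd0, div_le_iff₀ hd0]
        exact (hb v hv).2.2.trans (mul_le_mul_of_nonneg_left hd hu.le)
      have k1 := (abs_le.mp (key v (hSV hv))).2
      have k2 := (abs_le.mp (key v' (hSV hv'))).1
      have k3 := (abs_le.mp ((hA.upper _ (hb v (hSV hv)).1 _ (hb v' (hSV hv')).1).trans
        (mul_le_mul_of_nonneg_left close (by linarith)))).1
      have k4 : C * (6 / c) * u ≤ A * u := mul_le_mul_of_nonneg_right (by nlinarith) hu.le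
      have k5 : u ≤ A * u := by nlinarith
      nlinarith
    · intro v hv v' hv' hne
      have hd := (hV v (hSV hv)).2.1
      have hd' := (hV v' (hSV hv')).2.1
      have hdp : (0 : ℝ) < v.2.1 := by linarith
      have hdp' : (0 : ℝ) < v'.2.1 := by linarith
      have hdvd := dvd_cross_of_pairing_eq_zero hcw (hVw v (hSV hv)) (hVw v' (hSV hv'))
      have hcr : (cross v v').2.2 ≠ 0 := by
        intro h0
        apply hne
        have hcr1 : (cross v v').1 = 0 := by
          have : w.2.2 * (cross v v').1 = w.1 * (cross v v').2.2 := by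
            have e1 := hVw v (hSV hv)
            have e2 := hVw v' (hSV hv')
            simp only [cross, pairing] at e1 e2 ⊢
            linear_combination v.2.1 * e2 - v'.2.1 * e1
          rw [h0, mul_zero] at this
          exact (mul_eq_zero.mp this).resolve_left hh.ne'
        exact eq_of_cross_eq_zero (hV v (hSV hv)).1 (hV v' (hSV hv')).1
          (by exact_mod_cast hdp) (by exact_mod_cast hdp') hcr1 h0
      have hle : (w.2.2 : ℝ) ≤ |((cross v v').2.2 : ℝ)| := by
        have := Int.le_of_dvd (abs_pos.mpr hcr) ((dvd_abs _ _).mpr hdvd)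
        exact_mod_cast this
      have e : (v.1 : ℝ) / v.2.1 - v'.1 / v'.2.1 = (cross v v').2.2 / (v.2.1 * v'.2.1) := by
        simp only [cross]; push_cast; field_simp
      rw [e, abs_div, abs_of_pos (mul_pos hdp hdp'), div_le_div_iff₀ (by positivity)
        (mul_pos hdp hdp')]
      exact mul_le_mul hle (by nlinarith) (by positivity) (abs_nonneg _)
  have hsplit := Finset.card_filter_add_card_filter_not (s := V) (fun v => b v ≤ X)
  have s1 := side (V.filter (fun v => b v ≤ X)) (Finset.filter_subset _ _) (by
    intro v hv v' hv'
    exact Or.inl ⟨(Finset.mem_filter.mp hv).2, (Finset.mem_filter.mp hv').2⟩)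
  have s2 := side (V.filter (fun v => ¬ b v ≤ X)) (Finset.filter_subset _ _) (by
    intro v hv v' hv'
    exact Or.inr ⟨(not_le.mp (Finset.mem_filter.mp hv).2).le,
      (not_le.mp (Finset.mem_filter.mp hv').2).le⟩)
  have hs : (V.card : ℝ) = (V.filter (fun v => b v ≤ X)).card +
      (V.filter (fun v => ¬ b v ≤ X)).card := by exact_mod_cast hsplit.symm
  rw [hs]
  have e3 : 32 * A * (u * D ^ 2) / w.2.2 = 16 * A * (u * D ^ 2) / w.2.2 +
    16 * A * (u * D ^ 2) / w.2.2 := by ring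
  linarith

theorem CurvedArc.abs_sub_le {ξ η c C : ℝ} {f f' : ℝ → ℝ} (hA : CurvedArc ξ η c C f f') {x y : ℝ}
    (hx : x ∈ Icc ξ η) (hy : y ∈ Icc ξ η) : |f x - f y| ≤ C * |x - y| := by
  wlog hxy : x ≤ y generalizing x y
  · rw [abs_sub_comm, abs_sub_comm x]
    exact this hy hx (le_of_not_ge hxy)
  obtain ⟨z, hz, h⟩ := hA.slope x hx y hy hxy
  rw [abs_sub_comm, h, abs_mul, abs_sub_comm y]
  exact mul_le_mul_of_nonneg_right
    (hA.abs_deriv_le z ⟨hx.1.trans hz.1, hz.2.trans hy.2⟩) (abs_nonneg _)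

theorem CurvedArc.card_closeRational_le {ξ η c C : ℝ} {f f' : ℝ → ℝ}
    (hA : CurvedArc ξ η c C f f') {D u : ℝ} {h : ℤ} (W : Finset (ℤ × ℤ × ℤ)) (hh : 0 < h)
    (hW : ∀ w ∈ W, IsCloseRational ξ η c C f D u w ∧ w.2.2 = h) :
    (W.card : ℝ) ≤ (12 * arcConst c C ^ 2 * C + 12 * arcConst c C ^ 2 + 1) *
      ((C + 12 * arcConst c C ^ 2 + 1) * h) := by
  have hC := hA.one_le_C
  set B := arcConst c C ^ 2
  have hB : 0 ≤ B := sq_nonneg _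
  have hh1 : (1 : ℝ) ≤ h := by exact_mod_cast hh
  choose! b hb using fun w hw => (hW w hw).1.2.2.2
  have hb' : ∀ w ∈ W, b w ∈ Icc ξ η ∧ |(w.1 : ℝ) - h * b w| ≤ 6 * B ∧
      |(w.2.1 : ℝ) - h * f (b w)| ≤ 6 * B := by
    intro w hw
    have := hb w hw
    rwa [(hW w hw).2] at this
  refine card_le_mul_of_fiber W (fun w => w.1) (by positivity) ?_ ?_
  · have := card_int_le (s := W.image (fun w => w.1)) (L := h * C + 12 * B) (by positivity) ?_
    · nlinarith [mul_nonneg hB (by linarith : (0 : ℝ) ≤ h - 1)]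
    · intro a ha a' ha'
      obtain ⟨w, hw, rfl⟩ := Finset.mem_image.mp ha
      obtain ⟨w', hw', rfl⟩ := Finset.mem_image.mp ha'
      obtain ⟨i1, e1, -⟩ := hb' w hw
      obtain ⟨i2, e2, -⟩ := hb' w' hw'
      have e1 := (abs_le.mp e1).2
      have e2 := (abs_le.mp e2).1
      have : (h : ℝ) * (b w - b w') ≤ h * C :=
        mul_le_mul_of_nonneg_left (by linarith [i1.2, i2.1, hA.length_le]) (by linarith)
      linarith
  · intro a _
    set S := W.filter (fun w => w.1 = a) with hS
    have hinj : S.card = (S.image (fun w => w.2.1)).card := by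
      refine (Finset.card_image_of_injOn ?_).symm
      intro w hw w' hw' e
      simp only [hS, Finset.coe_filter, mem_ofPred_eq] at hw hw'
      exact Prod.ext (hw.2.trans hw'.2.symm)
        (Prod.ext e ((hW w hw.1).2.trans (hW w' hw'.1).2.symm))
    rw [hinj]
    refine card_int_le (by positivity) ?_
    intro x hx x' hx'
    obtain ⟨w, hw, rfl⟩ := Finset.mem_image.mp hx
    obtain ⟨w', hw', rfl⟩ := Finset.mem_image.mp hx'
    obtain ⟨hw, hwa⟩ := Finset.mem_filter.mp hw
    obtain ⟨hw', hwa'⟩ := Finset.mem_filter.mp hw'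
    obtain ⟨i1, e1, f1⟩ := hb' w hw
    obtain ⟨i2, e2, f2⟩ := hb' w' hw'
    rw [hwa] at e1
    rw [hwa'] at e2
    have hz : h * |b w - b w'| ≤ 12 * B := by
      have : h * |b w - b w'| = |((a : ℝ) - h * b w') - (a - h * b w)| := by
        rw [show ((a : ℝ) - h * b w') - (a - h * b w) = h * (b w - b w') by ring, abs_mul,
          abs_of_pos (by linarith : (0 : ℝ) < h)]
      rw [this]
      exact (abs_sub _ _).trans (by linarith)
    have hff := (le_abs_self _).trans (hA.abs_sub_le i1 i2)
    have h1 : (h : ℝ) * (f (b w) - f (b w')) ≤ h * (C * |b w - b w'|) :=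
      mul_le_mul_of_nonneg_left hff (by linarith)
    have h2 := mul_le_mul_of_nonneg_left hz (by linarith : 0 ≤ C)
    have f1 := (abs_le.mp f1).2
    have f2 := (abs_le.mp f2).1
    linarith

theorem CurvedArc.exists_card_nearPrimitive_le {ξ η c C : ℝ} {f f' : ℝ → ℝ}
    (hA : CurvedArc ξ η c C f f') {κ : ℝ} (hκ : 0 < κ) (hκ1 : 100 * arcConst c C ^ 2 * κ ≤ 1) :
    ∃ K : ℝ, 0 < K ∧ ∀ D u : ℝ, 1 ≤ D → 0 < u → u * D ≤ κ → ∀ V : Finset (ℤ × ℤ × ℤ),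
      (∀ v ∈ V, IsNearPrimitive ξ η f f' D u v) → (V.card : ℝ) ≤ K * (D + (u * D ^ 2) ^ 2) := by
  obtain ⟨-, -, -, -, hA1⟩ := hA.arcConst_ge
  have hC := hA.one_le_C
  set A := arcConst c C with hAdef
  set B := (12 * A ^ 2 * C + 12 * A ^ 2 + 1) * (C + 12 * A ^ 2 + 1) with hB
  refine ⟨2 * (C / κ + 2) + 4 * A * (32 * A * B), by positivity, ?_⟩
  intro D u hD hu huκ V hV
  have hD0 : 0 < D := by linarith
  choose! b hb using fun v hv => (hV v hv).2.2
  let bad : ℤ × ℤ × ℤ → Prop := fun v => ∃ w, IsCloseRational ξ η c C f D u w ∧ pairing v w = 0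
  have hgood : ((V.filter (fun v => ¬ bad v)).card : ℝ) ≤ 2 * (C / κ * D + 1 + 1) := by
    set G := V.filter (fun v => ¬ bad v) with hG
    have hGV : ∀ v ∈ G, v ∈ V ∧ ¬ bad v := fun v hv => Finset.mem_filter.mp hv
    refine card_le_mul_of_fiber G (fun v => ⌊b v * D / κ⌋) zero_le_two ?_ ?_
    · refine card_int_le (by positivity) ?_
      intro a ha a' ha'
      obtain ⟨v, hv, rfl⟩ := Finset.mem_image.mp ha
      obtain ⟨v', hv', rfl⟩ := Finset.mem_image.mp ha'
      have h1 := Int.floor_le (b v * D / κ)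
      have h2 := Int.lt_floor_add_one (b v' * D / κ)
      have i1 := (hb v (hGV v hv).1).1
      have i2 := (hb v' (hGV v' hv').1).1
      have : b v * D / κ - b v' * D / κ ≤ C / κ * D := by
        have : b v * D / κ - b v' * D / κ = (b v - b v') * (D / κ) := by ring
        rw [this, div_mul_eq_mul_div, ← mul_div_assoc]
        gcongr
        linarith [i1.2, i2.1, hA.length_le]
      linarith
    · intro a _
      by_contra hlt
      have hlt : 2 < (G.filter (fun v => ⌊b v * D / κ⌋ = a)).card := by
        by_contra hle
        exact hlt (by exact_mod_cast not_lt.mp hle)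
      obtain ⟨v₁, h1, v₂, h2, v₃, h3, n12, n13, n23⟩ := Finset.two_lt_card.mp hlt
      obtain ⟨h1, a1⟩ := Finset.mem_filter.mp h1
      obtain ⟨h2, a2⟩ := Finset.mem_filter.mp h2
      obtain ⟨h3, a3⟩ := Finset.mem_filter.mp h3
      have close : ∀ {x y : ℝ}, ⌊x * D / κ⌋ = ⌊y * D / κ⌋ → |x - y| ≤ κ / D := by
        intro x y h
        have := (Int.abs_sub_lt_one_of_floor_eq_floor h).le
        have e : x * D / κ - y * D / κ = (x - y) * (D / κ) := by ring
        rw [e, abs_mul, abs_of_pos (by positivity : 0 < D / κ)] at this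
        rw [le_div_iff₀ hD0]
        rw [← mul_div_assoc, div_le_one hκ] at this
        exact this
      obtain ⟨V1, nb1⟩ := hGV _ h1
      obtain ⟨V2, -⟩ := hGV _ h2
      obtain ⟨V3, -⟩ := hGV _ h3
      exact nb1 (hA.exists_normal_of_triple hκ hκ1 hD hu huκ (hV _ V1).1 (hV _ V2).1 (hV _ V3).1
        (hV _ V1).2.1 (hV _ V2).2.1 (hV _ V3).2.1 (hb _ V1) (hb _ V2) (hb _ V3)
        (close (a2.trans a1.symm)) (close (a3.trans a1.symm)) n12 n13 n23)
  have hbad : ((V.filter bad).card : ℝ) ≤ 4 * A * (u * D ^ 2) * (32 * A * (u * D ^ 2) * B) := by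
    set S := V.filter bad with hS
    have hSV : ∀ v ∈ S, v ∈ V ∧ bad v := fun v hv => Finset.mem_filter.mp hv
    choose! w hw using fun v hv => (hSV v hv).2
    have hwim : ∀ y ∈ S.image w, IsCloseRational ξ η c C f D u y := by
      intro y hy
      obtain ⟨v, hv, rfl⟩ := Finset.mem_image.mp hy
      exact (hw v hv).1
    have hden : ∀ y ∈ S.image w, y.2.2 ∈ Finset.Icc 1 ⌊4 * A * u * D ^ 2⌋ := by
      intro y hy
      obtain ⟨-, h1, h2, -⟩ := hwim y hy
      exact Finset.mem_Icc.mpr ⟨h1, Int.le_floor.mpr h2⟩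
    rw [Finset.card_eq_sum_card_image w S, Nat.cast_sum]
    calc ∑ y ∈ S.image w, ((S.filter (fun v => w v = y)).card : ℝ)
        ≤ ∑ y ∈ S.image w, 32 * A * (u * D ^ 2) / y.2.2 := by
          refine Finset.sum_le_sum fun y hy => ?_
          refine hA.card_pairing_eq_zero_le hD hu (hwim y hy) _ ?_ ?_
          · intro v hv
            exact hV v (hSV v (Finset.mem_filter.mp hv).1).1
          · intro v hv
            obtain ⟨h1, h2⟩ := Finset.mem_filter.mp hv
            exact h2 ▸ (hw v h1).2
      _ = ∑ h ∈ Finset.Icc 1 ⌊4 * A * u * D ^ 2⌋, ∑ y ∈ S.image w with y.2.2 = h,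
            32 * A * (u * D ^ 2) / y.2.2 := (Finset.sum_fiberwise_of_maps_to hden _).symm
      _ ≤ ∑ h ∈ Finset.Icc 1 ⌊4 * A * u * D ^ 2⌋, 32 * A * (u * D ^ 2) * B := by
          refine Finset.sum_le_sum fun h hh => ?_
          have hh0 : 0 < h := (Finset.mem_Icc.mp hh).1
          have hh0' : (0 : ℝ) < h := by exact_mod_cast hh0
          have hcard := hA.card_closeRational_le (D := D) (u := u)
            ((S.image w).filter (fun y => y.2.2 = h)) hh0 (by
              intro y hy
              obtain ⟨h1, h2⟩ := Finset.mem_filter.mp hy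
              exact ⟨hwim y h1, h2⟩)
          have hconst : ∀ y ∈ (S.image w).filter (fun y => y.2.2 = h),
              32 * A * (u * D ^ 2) / y.2.2 ≤ 32 * A * (u * D ^ 2) / h := by
            intro y hy
            rw [(Finset.mem_filter.mp hy).2]
          refine (Finset.sum_le_card_nsmul _ _ _ hconst).trans ?_
          rw [nsmul_eq_mul]
          refine (mul_le_mul_of_nonneg_right hcard (by positivity)).trans (le_of_eq ?_)
          rw [hB, hAdef]
          field_simp
      _ ≤ _ := by
          rw [Finset.sum_const, nsmul_eq_mul, Int.card_Icc]
          refine mul_le_mul_of_nonneg_right ?_ (by positivity)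
          have h0 : (0 : ℤ) ≤ ⌊4 * A * u * D ^ 2⌋ := Int.floor_nonneg.mpr (by positivity)
          have e : ((⌊4 * A * u * D ^ 2⌋ + 1 - 1).toNat : ℝ) = (⌊4 * A * u * D ^ 2⌋ : ℝ) := by
            rw [add_sub_cancel_right]
            exact_mod_cast Int.toNat_of_nonneg h0
          rw [e]
          exact (Int.floor_le _).trans (le_of_eq (by ring))
  have hs : (V.card : ℝ) = (V.filter bad).card + (V.filter (fun v => ¬ bad v)).card := by
    exact_mod_cast (Finset.card_filter_add_card_filter_not (s := V) bad).symm
  rw [hs]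
  have h1 : 2 * (C / κ * D + 1 + 1) ≤ 2 * (C / κ + 2) * D := by linarith
  have h2 : 0 ≤ 4 * A * (32 * A * B) * D := by positivity
  have h3 : 0 ≤ 2 * (C / κ + 2) * (u * D ^ 2) ^ 2 := by positivity
  have h4 : 4 * A * (u * D ^ 2) * (32 * A * (u * D ^ 2) * B) =
    4 * A * (32 * A * B) * (u * D ^ 2) ^ 2 := by ring
  linarith

theorem volume_real_le_of_abs_sub_le {S : Set ℝ} {ℓ : ℝ} (hℓ : 0 ≤ ℓ)
    (h : ∀ x ∈ S, ∀ y ∈ S, |x - y| ≤ ℓ) : volume.real S ≤ ℓ := by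
  refine ENNReal.toReal_le_of_le_ofReal hℓ ((Real.volume_le_diam S).trans ?_)
  refine Metric.ediam_le fun x hx y hy => ?_
  rw [edist_dist, Real.dist_eq]
  exact ENNReal.ofReal_le_ofReal (h x hx y hy)

theorem volume_real_mono_Icc {ξ η : ℝ} {S T : Set ℝ} (hST : S ⊆ T) (hT : T ⊆ Icc ξ η) :
    volume.real S ≤ volume.real T :=
  measureReal_mono hST (measure_ne_top_of_subset hT measure_Icc_lt_top.ne)

theorem volume_real_le_sum {ξ η : ℝ} {ι : Type*} (s : Finset ι) (P : ι → Set ℝ) {a : ι → ℝ}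
    {S : Set ℝ} (hS : ∀ x ∈ S, ∃ i ∈ s, x ∈ P i) (hP : ∀ i ∈ s, P i ⊆ Icc ξ η)
    (ha : ∀ i ∈ s, volume.real (P i) ≤ a i) : volume.real S ≤ ∑ i ∈ s, a i := by
  refine le_trans (volume_real_mono_Icc (T := ⋃ i ∈ s, P i) ?_ (iUnion₂_subset hP))
    ((measureReal_biUnion_finset_le s P).trans (Finset.sum_le_sum ha))
  intro x hx
  simpa using hS x hx

theorem exists_dyadic_levels {τ R : ℝ} (hτ : 0 < τ) (hR : 0 ≤ R) :
    ∃ N : ℕ, (∀ i < N, 2 ^ i * τ ≤ R) ∧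
      (∀ y, τ ≤ y → y ≤ R → ∃ i < N, 2 ^ i * τ ≤ y ∧ y ≤ 2 * (2 ^ i * τ)) ∧
      ∑ i ∈ Finset.range N, 2 ^ i * τ ≤ 2 * R ∧
      ∑ i ∈ Finset.range N, (2 ^ i * τ)⁻¹ ≤ 2 / τ := by
  have key : ∀ y : ℝ, ∃ n : ℕ, y < 2 ^ n * τ := by
    intro y
    obtain ⟨n, hn⟩ := pow_unbounded_of_one_lt (y / τ) (one_lt_two : (1 : ℝ) < 2)
    exact ⟨n, (div_lt_iff₀ hτ).mp hn⟩
  have hsum : ∀ n : ℕ, ∑ i ∈ Finset.range n, 2 ^ i * τ = (2 ^ n - 1) * τ ∧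
      ∑ i ∈ Finset.range n, (2 ^ i * τ)⁻¹ = (2 - 2 * (2 ^ n)⁻¹) / τ := by
    intro n
    induction n with
    | zero => simp
    | succ n ih =>
      rw [Finset.sum_range_succ, Finset.sum_range_succ, ih.1, ih.2]
      refine ⟨by ring, ?_⟩
      rw [pow_succ]
      field_simp
      ring
  have hlt : ∀ i < Nat.find (key R), 2 ^ i * τ ≤ R := fun i hi => not_lt.mp (Nat.find_min _ hi)
  refine ⟨Nat.find (key R), hlt, ?_, ?_, ?_⟩
  · intro y hy hyR
    have h1 := Nat.find_spec (key y)
    obtain ⟨k, hk⟩ : ∃ k, Nat.find (key y) = k + 1 := by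
      refine Nat.exists_eq_succ_of_ne_zero fun h0 => ?_
      rw [h0] at h1
      simp only [pow_zero, one_mul] at h1
      linarith
    refine ⟨k, ?_, not_lt.mp (Nat.find_min (key y) (by omega)), ?_⟩
    · have : Nat.find (key y) ≤ Nat.find (key R) :=
        Nat.find_min' _ (hyR.trans_lt (Nat.find_spec (key R)))
      omega
    · rw [hk, pow_succ] at h1
      linarith
  · rw [(hsum _).1]
    rcases h : Nat.find (key R) with _ | k
    · simpa using hR
    · have := hlt k (by omega)
      rw [pow_succ]
      linarith
  · rw [(hsum _).2]
    gcongr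
    have : (0 : ℝ) < (2 ^ Nat.find (key R))⁻¹ := by positivity
    linarith

theorem volume_real_nint_le {g : ℝ → ℝ} {E : Set ℝ} {ξ η t t' ℓ δ : ℝ} (hE : E ⊆ Icc ξ η)
    (ht : 0 < t) (ht' : 0 ≤ t') (hℓ : 0 ≤ ℓ) (hδ : 0 ≤ δ)
    (hg : ∀ x ∈ E, ∀ y ∈ E, t * |x - y| ≤ |g x - g y| ∧ |g x - g y| ≤ t' * |x - y| ∧ |x - y| ≤ ℓ)
    (hn : ∀ x ∈ E, nint (g x) ≤ δ) :
    volume.real E ≤ (2 * (t' * ℓ + 2 * δ) + 1) * (2 * δ / t) := by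
  rcases E.eq_empty_or_nonempty with rfl | ⟨x₀, hx₀⟩
  · simp only [measureReal_empty]; positivity
  set s := Finset.Icc ⌈(round (g x₀) : ℝ) - (t' * ℓ + 2 * δ)⌉
      ⌊(round (g x₀) : ℝ) + (t' * ℓ + 2 * δ)⌋
    with hs
  have hcard : (s.card : ℝ) ≤ 2 * (t' * ℓ + 2 * δ) + 1 := by
    refine card_int_le (by positivity) ?_
    intro a ha b hb
    have h1 := Int.le_floor.mp (Finset.mem_Icc.mp ha).2
    have h2 := Int.ceil_le.mp (Finset.mem_Icc.mp hb).1
    linarith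
  refine (volume_real_le_sum s (fun n => {x ∈ E | round (g x) = n}) (a := fun _ => 2 * δ / t)
    ?_ (fun _ _ => (sep_subset _ _).trans hE) ?_).trans ?_
  · intro x hx
    refine ⟨round (g x), ?_, hx, rfl⟩
    have h1 := abs_le.mp (hn x hx)
    have h2 := abs_le.mp (hn x₀ hx₀)
    obtain ⟨-, h3, h4⟩ := hg x hx x₀ hx₀
    have h3 := abs_le.mp (h3.trans (mul_le_mul_of_nonneg_left h4 ht'))
    exact Finset.mem_Icc.mpr ⟨Int.ceil_le.mpr (by linarith), Int.le_floor.mpr (by linarith)⟩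
  · intro n _
    refine volume_real_le_of_abs_sub_le (by positivity) ?_
    rintro x ⟨hx, hxn⟩ y ⟨hy, hyn⟩
    have h1 := abs_le.mp (hn x hx)
    have h2 := abs_le.mp (hn y hy)
    rw [hxn] at h1
    rw [hyn] at h2
    rw [le_div_iff₀ ht, mul_comm]
    exact (hg x hx y hy).1.trans (abs_le.mpr ⟨by linarith, by linarith⟩)
  · rw [Finset.sum_const, nsmul_eq_mul]
    exact mul_le_mul_of_nonneg_right hcard (by positivity)

theorem abs_le_of_same_sign {t t' a b : ℝ} (ht : 0 < t) (ha : t ≤ |a| ∧ |a| ≤ t')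
    (hb : t ≤ |b| ∧ |b| ≤ t') (hs : 0 ≤ a ∧ 0 ≤ b ∨ a < 0 ∧ b < 0) {z : ℝ} (hz : z ∈ uIcc a b) :
    t ≤ |z| ∧ |z| ≤ t' ∧ |a - b| ≤ t' := by
  rw [mem_uIcc] at hz
  rcases hs with ⟨h1, h2⟩ | ⟨h1, h2⟩
  · rw [abs_of_nonneg h1] at ha
    rw [abs_of_nonneg h2] at hb
    have : 0 ≤ z := by rcases hz with hz | hz <;> linarith
    rw [abs_of_nonneg this, abs_le]
    rcases hz with hz | hz <;> refine ⟨?_, ?_, ?_, ?_⟩ <;> linarith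
  · rw [abs_of_neg h1] at ha
    rw [abs_of_neg h2] at hb
    have : z < 0 := by rcases hz with hz | hz <;> linarith
    rw [abs_of_neg this, abs_le]
    rcases hz with hz | hz <;> refine ⟨?_, ?_, ?_, ?_⟩ <;> linarith

theorem CurvedArc.abs_linForm_sub {ξ η c C : ℝ} {f f' : ℝ → ℝ} (hA : CurvedArc ξ η c C f f')
    (v : ℤ × ℤ × ℤ) {t t' x y : ℝ} (ht : 0 < t) (hx : x ∈ Icc ξ η) (hy : y ∈ Icc ξ η)
    (hx' : t ≤ |linSlope f' v x| ∧ |linSlope f' v x| ≤ t')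
    (hy' : t ≤ |linSlope f' v y| ∧ |linSlope f' v y| ≤ t')
    (hs : 0 ≤ linSlope f' v x ∧ 0 ≤ linSlope f' v y ∨ linSlope f' v x < 0 ∧ linSlope f' v y < 0) :
    t * |x - y| ≤ |linForm f v x - linForm f v y| ∧
      |linForm f v x - linForm f v y| ≤ t' * |x - y| ∧ c * |(v.2.1 : ℝ)| * |x - y| ≤ t' := by
  obtain ⟨z, -, h1, h2⟩ := hA.exists_mean_value v hx hy
  obtain ⟨h3, h4, h5⟩ := abs_le_of_same_sign ht hx' hy' hs h2
  rw [abs_sub_comm (linForm f v x), h1, abs_mul, abs_sub_comm y]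
  refine ⟨mul_le_mul_of_nonneg_right h3 (abs_nonneg _),
    mul_le_mul_of_nonneg_right h4 (abs_nonneg _), le_trans ?_ h5⟩
  have e : linSlope f' v x - linSlope f' v y = v.2.1 * (f' x - f' y) := by
    simp only [linSlope]; ring
  rw [e, abs_mul, mul_comm c, mul_assoc]
  exact mul_le_mul_of_nonneg_left (hA.lower x hx y hy) (abs_nonneg _)

theorem volume_real_le_of_sign {ξ η a : ℝ} {E : Set ℝ} (g : ℝ → ℝ) (hE : E ⊆ Icc ξ η)
    (h : ∀ S ⊆ E, (∀ x ∈ S, ∀ y ∈ S, 0 ≤ g x ∧ 0 ≤ g y ∨ g x < 0 ∧ g y < 0) →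
      volume.real S ≤ a) : volume.real E ≤ 2 * a := by
  have h1 := h {x ∈ E | 0 ≤ g x} (sep_subset _ _) fun x hx y hy => Or.inl ⟨hx.2, hy.2⟩
  have h2 := h {x ∈ E | g x < 0} (sep_subset _ _) fun x hx y hy => Or.inr ⟨hx.2, hy.2⟩
  have h3 : volume.real E ≤ volume.real ({x ∈ E | 0 ≤ g x} ∪ {x ∈ E | g x < 0}) := by
    refine volume_real_mono_Icc ?_ (union_subset ((sep_subset _ _).trans hE)
      ((sep_subset _ _).trans hE))
    intro x hx
    rcases le_or_gt 0 (g x) with h0 | h0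
    · exact Or.inl ⟨hx, h0⟩
    · exact Or.inr ⟨hx, h0⟩
  linarith [measureReal_union_le (μ := volume) {x ∈ E | 0 ≤ g x} {x ∈ E | g x < 0}]

theorem CurvedArc.volume_nint_level_le {ξ η c C : ℝ} {f f' : ℝ → ℝ}
    (hA : CurvedArc ξ η c C f f') (v : ℤ × ℤ × ℤ) {t t' ℓ δ : ℝ} (ht : 0 < t) (ht' : t ≤ t')
    (hℓ : 0 ≤ ℓ) (hδ : 0 ≤ δ)
    (hlen : ∀ x ∈ Icc ξ η, ∀ y ∈ Icc ξ η, c * |(v.2.1 : ℝ)| * |x - y| ≤ t' → |x - y| ≤ ℓ) :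
    volume.real {β ∈ Icc ξ η | nint (linForm f v β) ≤ δ ∧ t ≤ |linSlope f' v β| ∧
      |linSlope f' v β| ≤ t'} ≤ 2 * ((2 * (t' * ℓ + 2 * δ) + 1) * (2 * δ / t)) := by
  refine volume_real_le_of_sign (linSlope f' v) (sep_subset _ _) ?_
  intro S hS hs
  refine volume_real_nint_le (hS.trans (sep_subset _ _)) ht (ht.le.trans ht') hℓ hδ
    (g := linForm f v) ?_ (fun x hx => (hS hx).2.1)
  intro x hx y hy
  obtain ⟨h1, h2, h3⟩ := hA.abs_linForm_sub v ht (hS hx).1 (hS hy).1 (hS hx).2.2 (hS hy).2.2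
    (hs x hx y hy)
  exact ⟨h1, h2, hlen x (hS hx).1 y (hS hy).1 h3⟩

theorem CurvedArc.volume_flat_le {ξ η c C : ℝ} {f f' : ℝ → ℝ}
    (hA : CurvedArc ξ η c C f f') (v : ℤ × ℤ × ℤ) {τ : ℝ} (hτ : 0 ≤ τ) (hv : v.2.1 ≠ 0) :
    volume.real {β ∈ Icc ξ η | |linSlope f' v β| ≤ τ} ≤ 2 * τ / (c * |(v.2.1 : ℝ)|) := by
  have hc := hA.c_pos
  have hv' : 0 < |(v.2.1 : ℝ)| := abs_pos.mpr (by exact_mod_cast hv)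
  refine volume_real_le_of_abs_sub_le (by positivity) ?_
  rintro x ⟨hx, hx'⟩ y ⟨hy, hy'⟩
  rw [le_div_iff₀ (by positivity)]
  have h1 := mul_le_mul_of_nonneg_left (hA.lower x hx y hy) hv'.le
  rw [← abs_mul] at h1
  have e : (v.2.1 : ℝ) * (f' x - f' y) = linSlope f' v x - linSlope f' v y := by
    simp only [linSlope]; ring
  rw [e] at h1
  have h2 := abs_sub (linSlope f' v x) (linSlope f' v y)
  linarith

theorem CurvedArc.exists_volume_steep_le {ξ η c C : ℝ} {f f' : ℝ → ℝ}
    (hA : CurvedArc ξ η c C f f') {κ : ℝ} (hκ : 0 < κ) :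
    ∃ K : ℝ, 0 < K ∧ ∀ v : ℤ × ℤ × ℤ, (v.1 ≠ 0 ∨ v.2.1 ≠ 0) → ∀ δ : ℝ, 0 < δ → δ ≤ 1 →
      volume.real {β ∈ Icc ξ η | nint (linForm f v β) ≤ δ ∧ κ ≤ |linSlope f' v β|} ≤ K * δ := by
  have hc := hA.c_pos
  have hC := hA.one_le_C
  refine ⟨200 * C + 200 * C / c + 40 / κ, by positivity, ?_⟩
  intro v hv δ hδ hδ1
  have hfb : ∀ x ∈ Icc ξ η, |(v.2.1 : ℝ) * f' x| ≤ C * |(v.2.1 : ℝ)| := by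
    intro x hx
    rw [abs_mul, mul_comm]
    exact mul_le_mul_of_nonneg_right (hA.abs_deriv_le x hx) (abs_nonneg _)
  have hle : ∀ x ∈ Icc ξ η, |linSlope f' v x| ≤ |(v.1 : ℝ)| + C * |(v.2.1 : ℝ)| :=
    fun x hx => (abs_add_le _ _).trans (by linarith [hfb x hx])
  have hge : ∀ x ∈ Icc ξ η, |(v.1 : ℝ)| - C * |(v.2.1 : ℝ)| ≤ |linSlope f' v x| := by
    intro x hx
    have := abs_sub (linSlope f' v x) (v.2.1 * f' x)
    simp only [linSlope, add_sub_cancel_right] at this ⊢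
    linarith [hfb x hx]
  rcases le_or_gt (2 * C * |(v.2.1 : ℝ)|) |(v.1 : ℝ)| with hcase | hcase
  · have hv1 : v.1 ≠ 0 := by
      intro h0
      rw [h0] at hcase hv
      have h1 : |(v.2.1 : ℝ)| ≠ 0 := abs_ne_zero.mpr (by exact_mod_cast hv.resolve_left (by simp))
      have h2 := lt_of_le_of_ne (abs_nonneg _) h1.symm
      simp only [Int.cast_zero, abs_zero] at hcase
      nlinarith
    have ha : (1 : ℝ) ≤ |(v.1 : ℝ)| := by exact_mod_cast Int.one_le_abs hv1
    set a := |(v.1 : ℝ)|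
    have h := hA.volume_nint_level_le v (t := a / 2) (t' := 2 * a) (ℓ := C) (δ := δ)
      (by linarith) (by linarith) (by linarith) hδ.le (fun x hx y hy _ => by
        rw [abs_le]; constructor <;> linarith [hA.length_le, hx.1, hx.2, hy.1, hy.2])
    refine (volume_real_mono_Icc ?_ (sep_subset _ _)).trans (h.trans ?_)
    · rintro x ⟨hx, hx1, -⟩
      exact ⟨hx, hx1, by linarith [hge x hx], by linarith [hle x hx]⟩
    · have e : 2 * ((2 * (2 * a * C + 2 * δ) + 1) * (2 * δ / (a / 2))) =
        32 * C * δ + (4 * δ + 1) / a * 8 * δ := by field_simp; ring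
      rw [e]
      have h5 : (4 * δ + 1) / a ≤ 5 := by
        rw [div_le_iff₀ (by linarith)]; linarith
      have : 32 * C + (4 * δ + 1) / a * 8 ≤ 200 * C + 200 * C / c + 40 / κ := by
        have : 0 ≤ 200 * C / c + 40 / κ := by positivity
        linarith
      nlinarith
  · have hd : 0 < |(v.2.1 : ℝ)| := by
      by_contra h0
      have : |(v.2.1 : ℝ)| = 0 := le_antisymm (not_lt.mp h0) (abs_nonneg _)
      rw [this, mul_zero] at hcase
      linarith [abs_nonneg (v.1 : ℝ)]
    set d := |(v.2.1 : ℝ)| with hd_def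
    obtain ⟨N, -, hN1, hN2, hN3⟩ := exists_dyadic_levels hκ (R := 3 * C * d) (by positivity)
    refine (volume_real_le_sum (ξ := ξ) (η := η) (Finset.range N)
      (fun i => {β ∈ Icc ξ η | nint (linForm f v β) ≤ δ ∧ 2 ^ i * κ ≤ |linSlope f' v β| ∧
        |linSlope f' v β| ≤ 2 * (2 ^ i * κ)})
      (a := fun i => 32 * δ / (c * d) * (2 ^ i * κ) + 20 * δ * (2 ^ i * κ)⁻¹)
      ?_ (fun _ _ => sep_subset _ _) ?_).trans ?_
    · rintro x ⟨hx, hx1, hx2⟩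
      obtain ⟨i, hi, h1, h2⟩ := hN1 _ hx2 (by linarith [hle x hx])
      exact ⟨i, Finset.mem_range.mpr hi, hx, hx1, h1, h2⟩
    · intro i _
      set T := 2 ^ i * κ
      have hT : 0 < T := by positivity
      refine (hA.volume_nint_level_le v (ℓ := 2 * T / (c * d)) hT (by linarith) (by positivity)
        hδ.le ?_).trans ?_
      · intro x _ y _ h
        rw [le_div_iff₀ (by positivity), mul_comm]
        exact h
      · have e : 2 * ((2 * (2 * T * (2 * T / (c * d)) + 2 * δ) + 1) * (2 * δ / T)) =
          32 * δ / (c * d) * T + 4 * (4 * δ + 1) * δ * T⁻¹ := by field_simp; ring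
        rw [e]
        have : 4 * (4 * δ + 1) * δ ≤ 20 * δ := by nlinarith
        gcongr
    · rw [Finset.sum_add_distrib, ← Finset.mul_sum, ← Finset.mul_sum]
      have h1 : 32 * δ / (c * d) * ∑ i ∈ Finset.range N, 2 ^ i * κ ≤
          32 * δ / (c * d) * (2 * (3 * C * d)) := mul_le_mul_of_nonneg_left hN2 (by positivity)
      have h2 : 20 * δ * ∑ i ∈ Finset.range N, (2 ^ i * κ)⁻¹ ≤ 20 * δ * (2 / κ) :=
        mul_le_mul_of_nonneg_left hN3 (by positivity)
      have e1 : 32 * δ / (c * d) * (2 * (3 * C * d)) = 192 * (C / c * δ) := by field_simp; ring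
      have e2 : 0 ≤ C / c * δ := by positivity
      have e3 : 0 ≤ C * δ := by positivity
      have e4 : (200 * C + 200 * C / c + 40 / κ) * δ =
        200 * (C * δ) + 200 * (C / c * δ) + 20 * δ * (2 / κ) := by ring
      linarith

theorem CurvedArc.volume_linForm_level_le {ξ η c C : ℝ} {f f' : ℝ → ℝ}
    (hA : CurvedArc ξ η c C f f') (v : ℤ × ℤ × ℤ) {t t' δ : ℝ} (ht : 0 < t) (hδ : 0 ≤ δ) :
    volume.real {β ∈ Icc ξ η | |linForm f v β| ≤ δ ∧ t ≤ |linSlope f' v β| ∧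
      |linSlope f' v β| ≤ t'} ≤ 2 * (2 * δ / t) := by
  refine volume_real_le_of_sign (linSlope f' v) (sep_subset _ _) ?_
  intro S hS hs
  refine volume_real_le_of_abs_sub_le (by positivity) ?_
  intro x hx y hy
  have h1 := (hA.abs_linForm_sub v ht (hS hx).1 (hS hy).1 (hS hx).2.2 (hS hy).2.2
    (hs x hx y hy)).1
  have h2 := abs_sub (linForm f v x) (linForm f v y)
  rw [le_div_iff₀ ht, mul_comm]
  linarith [(hS hx).2.1, (hS hy).2.1]

/-- The part of the arc on which `v` is at most `δ` with slope at most `s`. -/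
def smallSet (ξ η : ℝ) (f f' : ℝ → ℝ) (s δ : ℝ) (v : ℤ × ℤ × ℤ) : Set ℝ :=
  {β ∈ Icc ξ η | |linForm f v β| ≤ δ ∧ |linSlope f' v β| ≤ s}

theorem CurvedArc.exists_sum_volume_primitive_le {ξ η c C : ℝ} {f f' : ℝ → ℝ}
    (hA : CurvedArc ξ η c C f f') {κ : ℝ} (hκ : 0 < κ) (hκ1 : 100 * arcConst c C ^ 2 * κ ≤ 1) :
    ∃ K : ℝ, 0 < K ∧ ∀ D δ : ℝ, 1 ≤ D → 0 < δ → δ * D ≤ κ ^ 2 → ∀ U : Finset (ℤ × ℤ × ℤ),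
      (∀ v ∈ U, content v = 1 ∧ D ≤ v.2.1 ∧ (v.2.1 : ℝ) ≤ 2 * D) →
      ∑ v ∈ U, volume.real (smallSet ξ η f f' (κ / 2) δ v) ≤ K * (δ * D ^ 2 + √(δ * D)) := by
  have hc := hA.c_pos
  obtain ⟨K, hK, hcount⟩ := hA.exists_card_nearPrimitive_le hκ hκ1
  refine ⟨K * (2 / c * (1 + κ) + 8 + 16 * κ), by positivity, ?_⟩
  intro D δ hD hδ hδD U hU
  have hD0 : 0 < D := by linarith
  set τ := √(δ * D) with hτ_def
  have hτ : 0 < τ := Real.sqrt_pos.mpr (by positivity)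
  have hτ2 : τ ^ 2 = δ * D := Real.sq_sqrt (by positivity)
  have hτκ : τ ≤ κ := Real.sqrt_le_iff.mpr ⟨hκ.le, hδD⟩
  have hsum : ∀ (P : ℤ × ℤ × ℤ → Set ℝ) (T a : ℝ), 0 < T → τ ≤ T → T ≤ κ → 0 ≤ a →
      (∀ v ∈ U, ∀ β ∈ P v, β ∈ Icc ξ η ∧ |linForm f v β| ≤ δ ∧ |linSlope f' v β| ≤ T) →
      (∀ v ∈ U, volume.real (P v) ≤ a) →
      ∑ v ∈ U, volume.real (P v) ≤ K * (D + T ^ 2 * D ^ 2) * a := by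
    intro P T a hT hτT hTκ ha hP hPa
    have h1 : ∑ v ∈ U, volume.real (P v) = ∑ v ∈ U with (P v).Nonempty, volume.real (P v) := by
      refine (Finset.sum_filter_of_ne fun v _ hne => ?_).symm
      by_contra hemp
      rw [not_nonempty_iff_eq_empty] at hemp
      exact hne (by rw [hemp, measureReal_empty])
    have huD : T / D * D = T := by field_simp
    have h2 := hcount D (T / D) hD (by positivity) (huD.le.trans hTκ)
      (U.filter fun v => (P v).Nonempty) (by
        intro v hv
        obtain ⟨hvU, β, hβ⟩ := Finset.mem_filter.mp hv
        obtain ⟨b1, b2, b3⟩ := hP v hvU β hβ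
        refine ⟨(hU v hvU).1, (hU v hvU).2, β, b1, b2.trans ?_, b3.trans huD.ge⟩
        have : (T / D) ^ 2 * D = T ^ 2 / D := by field_simp
        rw [this, le_div_iff₀ hD0, ← hτ2]
        exact pow_le_pow_left₀ hτ.le hτT 2)
    rw [h1]
    refine (Finset.sum_le_card_nsmul _ _ a fun v hv => hPa v (Finset.mem_filter.mp hv).1).trans ?_
    rw [nsmul_eq_mul]
    refine (mul_le_mul_of_nonneg_right h2 ha).trans (le_of_eq ?_)
    field_simp
  obtain ⟨N, hN0, hN1, hN2, hN3⟩ := exists_dyadic_levels hτ (R := κ / 2) (by positivity)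
  set Z : ℤ × ℤ × ℤ → Set ℝ := smallSet ξ η f f' τ δ with hZ
  set L : ℕ → ℤ × ℤ × ℤ → Set ℝ := fun i v => {β ∈ Icc ξ η | |linForm f v β| ≤ δ ∧
    2 ^ i * τ ≤ |linSlope f' v β| ∧ |linSlope f' v β| ≤ 2 * (2 ^ i * τ)} with hL
  have hsplit : ∀ v, volume.real (smallSet ξ η f f' (κ / 2) δ v) ≤
      volume.real (Z v) + ∑ i ∈ Finset.range N, volume.real (L i v) := by
    intro v
    refine (volume_real_mono_Icc (T := Z v ∪ ⋃ i ∈ Finset.range N, L i v) ?_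
      (union_subset (sep_subset _ _) (iUnion₂_subset fun _ _ => sep_subset _ _))).trans
      ((measureReal_union_le _ _).trans
        (add_le_add_right (measureReal_biUnion_finset_le _ _) _))
    rintro x ⟨hx, h1, h2⟩
    rcases le_total |linSlope f' v x| τ with h3 | h3
    · exact Or.inl ⟨hx, h1, h3⟩
    · obtain ⟨i, hi, h4, h5⟩ := hN1 _ h3 h2
      exact Or.inr (mem_iUnion₂.mpr ⟨i, Finset.mem_range.mpr hi, hx, h1, h4, h5⟩)
  have hZsum : ∑ v ∈ U, volume.real (Z v) ≤ K * (2 / c) * (τ + κ * (δ * D ^ 2)) := by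
    refine (hsum Z τ (2 * τ / (c * D)) hτ le_rfl hτκ (by positivity) (fun v _ β hβ => hβ) ?_).trans
      ?_
    · intro v hv
      obtain ⟨-, hd, -⟩ := hU v hv
      have hd0 : (0 : ℝ) < v.2.1 := by linarith
      refine (volume_real_mono_Icc (T := {β ∈ Icc ξ η | |linSlope f' v β| ≤ τ}) ?_
        (sep_subset _ _)).trans
        ((hA.volume_flat_le v hτ.le (by exact_mod_cast hd0.ne')).trans ?_)
      · exact fun x hx => ⟨hx.1, hx.2.2⟩
      · rw [abs_of_pos hd0]
        gcongr
    · have e : K * (D + τ ^ 2 * D ^ 2) * (2 * τ / (c * D)) =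
        K * (2 / c) * (τ + τ * (δ * D ^ 2)) := by
        rw [hτ2]; field_simp
      rw [e]
      gcongr
  have hLsum : ∀ i ∈ Finset.range N, ∑ v ∈ U, volume.real (L i v) ≤
      4 * K * (δ * D) * (2 ^ i * τ)⁻¹ + 16 * K * (δ * D ^ 2) * (2 ^ i * τ) := by
    intro i hi
    have hT0 := hN0 i (Finset.mem_range.mp hi)
    set T := 2 ^ i * τ
    have hT : 0 < T := by positivity
    have hτT : τ ≤ T := le_mul_of_one_le_left hτ.le (one_le_pow₀ one_le_two)
    refine (hsum (L i) (2 * T) (2 * (2 * δ / T)) (by positivity) (by linarith) (by linarith)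
      (by positivity) (fun v _ β hβ => ⟨hβ.1, hβ.2.1, hβ.2.2.2⟩)
      (fun v _ => hA.volume_linForm_level_le v hT hδ.le)).trans (le_of_eq ?_)
    field_simp
    ring
  calc ∑ v ∈ U, volume.real (smallSet ξ η f f' (κ / 2) δ v)
      ≤ ∑ v ∈ U, (volume.real (Z v) + ∑ i ∈ Finset.range N, volume.real (L i v)) :=
        Finset.sum_le_sum fun v _ => hsplit v
    _ = ∑ v ∈ U, volume.real (Z v) + ∑ i ∈ Finset.range N, ∑ v ∈ U, volume.real (L i v) := by
        rw [Finset.sum_add_distrib, Finset.sum_comm (s := U)]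
    _ ≤ K * (2 / c) * (τ + κ * (δ * D ^ 2)) + ∑ i ∈ Finset.range N,
          (4 * K * (δ * D) * (2 ^ i * τ)⁻¹ + 16 * K * (δ * D ^ 2) * (2 ^ i * τ)) :=
        add_le_add hZsum (Finset.sum_le_sum hLsum)
    _ ≤ K * (2 / c) * (τ + κ * (δ * D ^ 2)) + (4 * K * (δ * D) * (2 / τ) +
          16 * K * (δ * D ^ 2) * (2 * (κ / 2))) := by
        rw [Finset.sum_add_distrib, ← Finset.mul_sum, ← Finset.mul_sum]
        gcongr
    _ ≤ _ := by
        have e : 4 * K * (δ * D) * (2 / τ) = 8 * (K * τ) := by rw [← hτ2]; field_simp; ring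
        rw [e]
        have i1 : 0 ≤ K * (δ * D ^ 2) := by positivity
        have i2 : 0 ≤ K * τ * κ := by positivity
        have i3 : 0 ≤ K * (2 / c) * (κ * τ) := by positivity
        have i4 : 0 ≤ K * (2 / c) * (δ * D ^ 2) := by positivity
        linarith

theorem sum_range_succ_pow_le {x : ℝ} (hx : 4 / 3 ≤ x) (m : ℕ) :
    ∑ i ∈ Finset.range (m + 1), x ^ i ≤ 4 * x ^ m := by
  induction m with
  | zero => norm_num
  | succ m ih =>
    rw [Finset.sum_range_succ]
    have : 0 ≤ x ^ m * (3 * x - 4) := mul_nonneg (pow_nonneg (by linarith) _) (by linarith)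
    rw [pow_succ]
    linarith

theorem sum_Icc_inv_sq_le (J : ℕ) : ∑ k ∈ Finset.Icc 1 J, ((k : ℝ) ^ 2)⁻¹ ≤ 2 := by
  have h := sum_Ioo_inv_sq_le (α := ℝ) 0 (J + 1)
  have e : Finset.Icc 1 J = Finset.Ioo 0 (J + 1) := by ext; simp; omega
  rw [e]
  simpa using h

theorem sum_Icc_inv_le {J : ℕ} (hJ : 2 ≤ J) :
    ∑ k ∈ Finset.Icc 1 J, (k : ℝ)⁻¹ ≤ 3 * Real.log J := by
  have h := harmonic_le_one_add_log J
  rw [harmonic_eq_sum_Icc] at h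
  push_cast at h
  have h2 : Real.log 2 ≤ Real.log J := Real.log_le_log two_pos (by exact_mod_cast hJ)
  linarith [Real.log_two_gt_d9]

theorem smallSet_scale_subset (ξ η : ℝ) (f f' : ℝ → ℝ) {s δ : ℝ} {k : ℕ} (hk : 0 < k)
    (w : ℤ × ℤ × ℤ) : smallSet ξ η f f' s δ (scale k w) ⊆ smallSet ξ η f f' s (δ / k) w := by
  have hk1 : (1 : ℝ) ≤ k := by exact_mod_cast hk
  rintro x ⟨hx, h1, h2⟩
  have e1 : linForm f (scale k w) x = k * linForm f w x := by
    simp only [linForm, scale]; push_cast; ring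
  have e2 : linSlope f' (scale k w) x = k * linSlope f' w x := by
    simp only [linSlope, scale]; push_cast; ring
  rw [e1, abs_mul, abs_of_pos (by linarith)] at h1
  rw [e2, abs_mul, abs_of_pos (by linarith)] at h2
  refine ⟨hx, (le_div_iff₀' (by linarith)).mpr h1, le_trans ?_ h2⟩
  exact le_mul_of_one_le_left (abs_nonneg _) hk1

theorem CurvedArc.exists_sum_volume_smallSet_le {ξ η c C : ℝ} {f f' : ℝ → ℝ}
    (hA : CurvedArc ξ η c C f f') {κ : ℝ} (hκ : 0 < κ) (hκ1 : 100 * arcConst c C ^ 2 * κ ≤ 1) :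
    ∃ K : ℝ, 0 < K ∧ ∀ J : ℕ, 2 ≤ J → ∀ δ : ℝ, 0 < δ → ∀ V : Finset (ℤ × ℤ × ℤ),
      (∀ v ∈ V, 0 < v.2.1 ∧ v.2.1 ≤ J ∧ δ * v.2.1 ≤ κ ^ 2) →
      ∑ v ∈ V, volume.real (smallSet ξ η f f' (κ / 2) δ v) ≤
        K * (δ * (J : ℝ) ^ 2 + √(δ * J) * Real.log J) := by
  obtain ⟨K, hK, hprim⟩ := hA.exists_sum_volume_primitive_le hκ hκ1
  refine ⟨12 * K, by positivity, ?_⟩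
  intro J hJ δ hδ V hV
  choose! w hw using fun v (hv : v ∈ V) =>
    exists_scale_content v (Or.inl (hV v hv).1.ne')
  have hdeg : ∀ v ∈ V, v.2.1 = content v * (w v).2.1 := fun v hv =>
    congrArg (fun t => t.2.1) (hw v hv).1
  have hwpos : ∀ v ∈ V, 0 < (w v).2.1 := by
    intro v hv
    have h1 := (hV v hv).1
    rw [hdeg v hv] at h1
    exact pos_of_mul_pos_right h1 (by positivity)
  have hwnat : ∀ v ∈ V, content v * (w v).2.1.toNat ≤ J := by
    intro v hv
    have h1 := (hV v hv).2.1
    rw [hdeg v hv, ← Int.toNat_of_nonneg (hwpos v hv).le] at h1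
    exact_mod_cast h1
  have hwone : ∀ v ∈ V, 1 ≤ (w v).2.1.toNat := fun v hv => by have := hwpos v hv; omega
  have hcontent : ∀ v ∈ V, content v ∈ Finset.Icc 1 J := fun v hv =>
    Finset.mem_Icc.mpr ⟨(hw v hv).2.2,
      le_trans (Nat.le_mul_of_pos_right _ (hwone v hv)) (hwnat v hv)⟩
  have hclass : ∀ k ∈ Finset.Icc 1 J, ∑ v ∈ V with content v = k,
      volume.real (smallSet ξ η f f' (κ / 2) δ v) ≤
      4 * K * (δ * (J : ℝ) ^ 2) * ((k : ℝ) ^ 2)⁻¹ + 4 * K * √(δ * J) * (k : ℝ)⁻¹ := by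
    intro k hk
    obtain ⟨hk1, hkJ⟩ := Finset.mem_Icc.mp hk
    have hk0 : (1 : ℝ) ≤ k := by exact_mod_cast hk1
    set m := Nat.log 2 (J / k) with hm
    have hm2 : (2 : ℝ) ^ m ≤ J / k := by
      have : 2 ^ m ≤ J / k := Nat.pow_log_le_self 2 (Nat.div_pos hkJ hk1).ne'
      have h2 : ((2 ^ m : ℕ) : ℝ) ≤ ((J / k : ℕ) : ℝ) := by exact_mod_cast this
      push_cast at h2
      exact h2.trans Nat.cast_div_le
    have hmaps : ∀ v ∈ V.filter (fun v => content v = k),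
        Nat.log 2 (w v).2.1.toNat ∈ Finset.range (m + 1) := by
      intro v hv
      obtain ⟨hvV, hvk⟩ := Finset.mem_filter.mp hv
      refine Finset.mem_range.mpr (Nat.lt_succ_of_le (Nat.log_mono_right ?_))
      rw [Nat.le_div_iff_mul_le hk1, mul_comm, ← hvk]
      exact hwnat v hvV
    rw [← Finset.sum_fiberwise_of_maps_to hmaps]
    have hpiece : ∀ i ∈ Finset.range (m + 1),
        ∑ v ∈ (V.filter (fun v => content v = k)).filter
          (fun v => Nat.log 2 (w v).2.1.toNat = i),
          volume.real (smallSet ξ η f f' (κ / 2) δ v) ≤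
        K * (δ / k) * 4 ^ i + K * √(δ / k) * √2 ^ i := by
      intro i _
      set S := (V.filter (fun v => content v = k)).filter
        (fun v => Nat.log 2 (w v).2.1.toNat = i) with hS
      have hSmem : ∀ v ∈ S, v ∈ V ∧ content v = k ∧ Nat.log 2 (w v).2.1.toNat = i := by
        intro v hv
        obtain ⟨h1, h2⟩ := Finset.mem_filter.mp hv
        obtain ⟨h3, h4⟩ := Finset.mem_filter.mp h1
        exact ⟨h3, h4, h2⟩
      rcases S.eq_empty_or_nonempty with hemp | ⟨v₀, hv₀⟩
      · rw [hemp, Finset.sum_empty]; positivity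
      have hdyad : ∀ v ∈ S, (2 : ℝ) ^ i ≤ (w v).2.1 ∧ ((w v).2.1 : ℝ) ≤ 2 * 2 ^ i := by
        intro v hv
        obtain ⟨h1, -, h3⟩ := hSmem v hv
        have e : ((w v).2.1 : ℝ) = ((w v).2.1.toNat : ℝ) := by
          exact_mod_cast (Int.toNat_of_nonneg (hwpos v h1).le).symm
        rw [e]
        constructor
        · have := Nat.pow_log_le_self 2 (x := (w v).2.1.toNat) (by have := hwone v h1; omega)
          rw [h3] at this
          exact_mod_cast this
        · have := (Nat.lt_pow_succ_log_self one_lt_two (w v).2.1.toNat).le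
          rw [h3, pow_succ, mul_comm] at this
          exact_mod_cast this
      have hinj : Set.InjOn w S := by
        intro v hv v' hv' h
        rw [(hw v (hSmem v hv).1).1, (hw v' (hSmem v' hv').1).1, (hSmem v hv).2.1,
          (hSmem v' hv').2.1, h]
      have hD : δ / k * 2 ^ i ≤ κ ^ 2 := by
        obtain ⟨h1, h2, -⟩ := hSmem v₀ hv₀
        have h3 := (hV v₀ h1).2.2
        rw [hdeg v₀ h1, h2] at h3
        push_cast at h3
        have h4 := (hdyad v₀ hv₀).1
        have h5 : δ / k * 2 ^ i ≤ δ * 2 ^ i :=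
          mul_le_mul_of_nonneg_right (div_le_self hδ.le hk0) (by positivity)
        have h6 : δ * 2 ^ i ≤ δ * (k * (w v₀).2.1) :=
          mul_le_mul_of_nonneg_left (h4.trans (le_mul_of_one_le_left
            ((by positivity : (0 : ℝ) ≤ 2 ^ i).trans h4) hk0)) hδ.le
        linarith
      have h := hprim (2 ^ i) (δ / k) (one_le_pow₀ one_le_two) (by positivity) hD (S.image w) (by
        intro u hu
        obtain ⟨v, hv, rfl⟩ := Finset.mem_image.mp hu
        exact ⟨(hw v (hSmem v hv).1).2.1, hdyad v hv⟩)
      rw [Finset.sum_image hinj] at h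
      refine le_trans (Finset.sum_le_sum fun v hv => ?_) (h.trans (le_of_eq ?_))
      · have hsub := smallSet_scale_subset ξ η f f' (s := κ / 2) (δ := δ) hk1 (w v)
        rw [← (hSmem v hv).2.1, ← (hw v (hSmem v hv).1).1, (hSmem v hv).2.1] at hsub
        exact volume_real_mono_Icc hsub (sep_subset _ _)
      · have e1 : √((2 : ℝ) ^ i) = √2 ^ i := by
          rw [Real.sqrt_eq_iff_eq_sq (by positivity) (by positivity), ← pow_mul, mul_comm, pow_mul,
            Real.sq_sqrt zero_le_two]
        rw [Real.sqrt_mul (by positivity), e1, ← pow_mul, mul_comm i 2, pow_mul]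
        norm_num
        ring
    refine (Finset.sum_le_sum hpiece).trans ?_
    rw [Finset.sum_add_distrib, ← Finset.mul_sum, ← Finset.mul_sum]
    have hs2 : (4 : ℝ) / 3 ≤ √2 := Real.le_sqrt_of_sq_le (by norm_num)
    have g1 := sum_range_succ_pow_le (x := 4) (by norm_num) m
    have g2 := sum_range_succ_pow_le hs2 m
    have g3 : (4 : ℝ) ^ m ≤ (J / k) ^ 2 := by
      have : (4 : ℝ) ^ m = (2 ^ m) ^ 2 := by rw [← pow_mul, mul_comm, pow_mul]; norm_num
      rw [this]
      exact pow_le_pow_left₀ (by positivity) hm2 2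
    have g4 : √2 ^ m ≤ √(J / k) := by
      refine Real.le_sqrt_of_sq_le ?_
      rw [← pow_mul, mul_comm, pow_mul, Real.sq_sqrt zero_le_two]
      exact hm2
    have g5 : √(δ / k) * √(J / k) = √(δ * J) * (k : ℝ)⁻¹ := by
      rw [← Real.sqrt_mul (by positivity),
        show δ / k * (J / k) = δ * J / (k : ℝ) ^ 2 by field_simp, Real.sqrt_div (by positivity),
        Real.sqrt_sq (by positivity), div_eq_mul_inv]
    have g6 : δ / k * (J / k : ℝ) ^ 2 ≤ δ * (J : ℝ) ^ 2 * ((k : ℝ) ^ 2)⁻¹ := by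
      have : δ / k * (J / k : ℝ) ^ 2 = δ * (J : ℝ) ^ 2 * ((k : ℝ) ^ 2)⁻¹ / k := by field_simp
      rw [this]
      exact div_le_self (by positivity) hk0
    have t1 : K * (δ / k) * ∑ i ∈ Finset.range (m + 1), (4 : ℝ) ^ i ≤
        K * (δ / k) * (4 * (J / k) ^ 2) :=
      mul_le_mul_of_nonneg_left (g1.trans (by linarith)) (by positivity)
    have t2 : K * √(δ / k) * ∑ i ∈ Finset.range (m + 1), √2 ^ i ≤
        K * √(δ / k) * (4 * √(J / k)) :=
      mul_le_mul_of_nonneg_left (g2.trans (by linarith)) (by positivity)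
    have t3 : K * √(δ / k) * (4 * √(J / k)) = 4 * K * √(δ * J) * (k : ℝ)⁻¹ := by
      linear_combination 4 * K * g5
    have t4 : K * (δ / k * (J / k : ℝ) ^ 2) ≤ K * (δ * (J : ℝ) ^ 2 * ((k : ℝ) ^ 2)⁻¹) :=
      mul_le_mul_of_nonneg_left g6 hK.le
    linarith
  rw [← Finset.sum_fiberwise_of_maps_to hcontent]
  refine (Finset.sum_le_sum hclass).trans ?_
  rw [Finset.sum_add_distrib, ← Finset.mul_sum, ← Finset.mul_sum]
  have t1 := mul_le_mul_of_nonneg_left (sum_Icc_inv_sq_le J)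
    (by positivity : 0 ≤ 4 * K * (δ * (J : ℝ) ^ 2))
  have t2 := mul_le_mul_of_nonneg_left (sum_Icc_inv_le hJ)
    (by positivity : 0 ≤ 4 * K * √(δ * J))
  have t3 : 0 ≤ K * (δ * (J : ℝ) ^ 2) := by positivity
  linarith

theorem nint_neg (y : ℝ) : nint (-y) = nint y := by
  have key : ∀ y : ℝ, nint (-y) ≤ nint y := by
    intro y
    refine (round_le (-y) (-round y)).trans (le_of_eq ?_)
    rw [nint, abs_sub_comm]
    push_cast
    congr 1
    ring
  exact le_antisymm (key y) (by simpa using key (-y))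

/-- The part of the arc on which the form `j` is within `δ` of an integer, with slope at most
`s`. -/
def nearSet (ξ η : ℝ) (f f' : ℝ → ℝ) (s δ : ℝ) (j : ℤ × ℤ) : Set ℝ :=
  {β ∈ Icc ξ η | nint (linForm f (j.1, j.2, 0) β) ≤ δ ∧ |linSlope f' (j.1, j.2, 0) β| ≤ s}

theorem nearSet_neg (ξ η : ℝ) (f f' : ℝ → ℝ) (s δ : ℝ) (j : ℤ × ℤ) :
    nearSet ξ η f f' s δ (-j) = nearSet ξ η f f' s δ j := by
  ext β
  have e1 : linForm f (-j.1, -j.2, 0) β = - linForm f (j.1, j.2, 0) β := by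
    simp only [linForm]; push_cast; ring
  have e2 : linSlope f' (-j.1, -j.2, 0) β = - linSlope f' (j.1, j.2, 0) β := by
    simp only [linSlope]; push_cast; ring
  change (_ ∧ nint (linForm f (-j.1, -j.2, 0) β) ≤ δ ∧ |linSlope f' (-j.1, -j.2, 0) β| ≤ s) ↔
    (_ ∧ _ ∧ _)
  rw [e1, e2, nint_neg, abs_neg]

theorem CurvedArc.exists_sum_volume_nearSet_le {ξ η c C : ℝ} {f f' : ℝ → ℝ}
    (hA : CurvedArc ξ η c C f f') {κ : ℝ} (hκ : 0 < κ) (hκ1 : 100 * arcConst c C ^ 2 * κ ≤ 1) :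
    ∃ K : ℝ, 0 < K ∧ ∀ J : ℕ, 2 ≤ J → ∀ δ : ℝ, 0 < δ → ∀ P : Finset (ℤ × ℤ),
      (∀ j ∈ P, |j.1| ≤ J ∧ 0 < j.2 ∧ j.2 ≤ J ∧ δ * j.2 ≤ κ ^ 2) →
      ∑ j ∈ P, volume.real (nearSet ξ η f f' (κ / 2) δ j) ≤
        K * (δ * (J : ℝ) ^ 2 + √(δ * J) * Real.log J) := by
  have hC := hA.one_le_C
  obtain ⟨K, hK, h⟩ := hA.exists_sum_volume_smallSet_le hκ hκ1
  refine ⟨K, hK, ?_⟩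
  intro J hJ δ hδ P hP
  set M : ℝ := |ξ| + |η| + |f ξ| + C * C with hM
  have hbound : ∀ j ∈ P, ∀ β ∈ Icc ξ η, |linForm f (j.1, j.2, 0) β| ≤ J * M := by
    intro j hj β hβ
    obtain ⟨h1, h2, h3, -⟩ := hP j hj
    have h1' : |(j.1 : ℝ)| ≤ J := by exact_mod_cast h1
    have h3' : |(j.2 : ℝ)| ≤ J := by
      rw [abs_of_pos (by exact_mod_cast h2)]; exact_mod_cast h3
    have hβ' : |β| ≤ |ξ| + |η| :=
      (abs_le_max_abs_abs hβ.1 hβ.2).trans (max_le_add_of_nonneg (abs_nonneg _) (abs_nonneg _))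
    have hξ : ξ ∈ Icc ξ η := ⟨le_rfl, hβ.1.trans hβ.2⟩
    have hfβ : |f β| ≤ |f ξ| + C * C := by
      have e1 := hA.abs_sub_le hβ hξ
      have e2 : |β - ξ| ≤ C := by
        rw [abs_of_nonneg (by linarith [hβ.1])]; linarith [hβ.2, hA.length_le]
      have e3 := abs_sub_abs_le_abs_sub (f β) (f ξ)
      have e4 : C * |β - ξ| ≤ C * C := mul_le_mul_of_nonneg_left e2 (by linarith)
      linarith
    simp only [linForm, Int.cast_zero, add_zero]
    refine (abs_add_le _ _).trans ?_
    rw [abs_mul, abs_mul]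
    have t1 : |(j.1 : ℝ)| * |β| ≤ J * (|ξ| + |η|) :=
      mul_le_mul h1' hβ' (abs_nonneg _) (by positivity)
    have t2 : |(j.2 : ℝ)| * |f β| ≤ J * (|f ξ| + C * C) :=
      mul_le_mul h3' hfβ (abs_nonneg _) (by positivity)
    have t3 : (J : ℝ) * M = J * (|ξ| + |η|) + J * (|f ξ| + C * C) := by rw [hM]; ring
    linarith
  set n₀ : ℤ := ⌈(J : ℝ) * M + 1⌉ with hn₀
  set V : Finset (ℤ × ℤ × ℤ) :=
    (P ×ˢ Finset.Icc (-n₀) n₀).map (Equiv.prodAssoc ℤ ℤ ℤ).toEmbedding with hV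
  have hVsum := h J hJ δ hδ V (by
    intro v hv
    obtain ⟨⟨j, n⟩, hjn, rfl⟩ := Finset.mem_map.mp hv
    exact (hP j (Finset.mem_product.mp hjn).1).2)
  rw [hV, Finset.sum_map, Finset.sum_product] at hVsum
  refine le_trans (Finset.sum_le_sum fun j hj => ?_) hVsum
  refine volume_real_le_sum (ξ := ξ) (η := η) (Finset.Icc (-n₀) n₀) _ ?_
    (fun _ _ => sep_subset _ _) (fun _ _ => le_rfl)
  rintro β ⟨hβ, h1, h2⟩
  have h3 := abs_le.mp (hbound j hj β hβ)
  set y := linForm f (j.1, j.2, 0) β with hy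
  have h4 := abs_le.mp (abs_sub_round y)
  have h5 := Int.le_ceil ((J : ℝ) * M + 1)
  refine ⟨-round y, Finset.mem_Icc.mpr ⟨?_, ?_⟩, hβ, ?_, ?_⟩
  · have : (round y : ℝ) ≤ n₀ := by linarith [h3.2, h4.1]
    exact neg_le_neg (by exact_mod_cast this)
  · have : (-round y : ℝ) ≤ n₀ := by linarith [h3.1, h4.2]
    exact_mod_cast this
  · have : linForm f (Equiv.prodAssoc ℤ ℤ ℤ (j, -round y)) β = y - round y := by
      simp only [linForm, Equiv.prodAssoc_apply, hy]; push_cast; ring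
    simp only [Equiv.coe_toEmbedding]
    rw [this]
    exact h1
  · exact h2

theorem CurvedArc.exists_sum_volume_nint_le {ξ η c C : ℝ} {f f' : ℝ → ℝ}
    (hA : CurvedArc ξ η c C f f') :
    ∃ K : ℝ, 0 < K ∧ ∀ J : ℕ, 2 ≤ J → ∀ δ : ℝ, 0 < δ → δ ≤ 1 →
      ∑ j ∈ (Finset.Icc (-(J : ℤ)) J ×ˢ Finset.Icc (-(J : ℤ)) J).erase (0, 0),
        volume.real {β ∈ Icc ξ η | nint (linForm f (j.1, j.2, 0) β) ≤ δ} ≤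
      K * (δ * (J : ℝ) ^ 2 + √(δ * J) * Real.log J) := by
  obtain ⟨-, -, -, -, hA1⟩ := hA.arcConst_ge
  have hc := hA.c_pos
  set κ : ℝ := 1 / (100 * arcConst c C ^ 2) with hκ_def
  have hκ : 0 < κ := by positivity
  have hκ1 : 100 * arcConst c C ^ 2 * κ ≤ 1 := by rw [hκ_def]; field_simp; rfl
  have hκ2 : κ ≤ 1 := by nlinarith
  obtain ⟨K₁, hK₁, hsteep⟩ := hA.exists_volume_steep_le (half_pos hκ)
  obtain ⟨K₂, hK₂, hnear⟩ := hA.exists_sum_volume_nearSet_le hκ hκ1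
  refine ⟨9 * (K₁ + 1 / (c * κ)) + 2 * K₂, by positivity, ?_⟩
  intro J hJ δ hδ hδ1
  set box := (Finset.Icc (-(J : ℤ)) J ×ˢ Finset.Icc (-(J : ℤ)) J).erase (0, 0) with hbox
  have hbox_mem : ∀ j ∈ box, j ≠ (0, 0) ∧ |j.1| ≤ J ∧ |j.2| ≤ J := by
    intro j hj
    obtain ⟨h1, h2⟩ := Finset.mem_erase.mp hj
    obtain ⟨h3, h4⟩ := Finset.mem_product.mp h2
    exact ⟨h1, abs_le.mpr (Finset.mem_Icc.mp h3), abs_le.mpr (Finset.mem_Icc.mp h4)⟩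
  set G : ℤ × ℤ → ℝ := fun j => volume.real (nearSet ξ η f f' (κ / 2) δ j) with hG
  have hG0 : ∀ j, 0 ≤ G j := fun j => measureReal_nonneg
  have hGneg : ∀ j, G (-j) = G j := fun j => by simp only [hG, nearSet_neg]
  let p : ℤ × ℤ → Prop := fun j => 0 < j.2 ∧ δ * j.2 ≤ κ ^ 2
  have hGj : ∀ j ∈ box, G j ≤ 1 / (c * κ) * δ + (if p j then G j else 0) +
      (if p (-j) then G j else 0) := by
    intro j hj
    obtain ⟨hj0, -, -⟩ := hbox_mem j hj
    have hδ' : 0 ≤ 1 / (c * κ) * δ := by positivity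
    have i1 : 0 ≤ if p j then G j else 0 := by split_ifs <;> simp [hG0]
    have i2 : 0 ≤ if p (-j) then G j else 0 := by split_ifs <;> simp [hG0]
    rcases eq_or_ne j.2 0 with h0 | h0
    · have hj1 : j.1 ≠ 0 := fun h1 => hj0 (Prod.ext h1 h0)
      have hemp : nearSet ξ η f f' (κ / 2) δ j = ∅ := by
        refine eq_empty_of_forall_notMem ?_
        rintro β ⟨-, -, h⟩
        have h1 : (1 : ℝ) ≤ |(j.1 : ℝ)| := by exact_mod_cast Int.one_le_abs hj1
        simp only [linSlope, h0, Int.cast_zero, zero_mul, add_zero] at h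
        linarith
      have : G j = 0 := by simp only [hG, hemp, measureReal_empty]
      linarith
    · rcases le_or_gt (δ * |(j.2 : ℝ)|) (κ ^ 2) with hle | hgt
      · rcases lt_or_gt_of_ne h0 with hneg | hpos
        · have : p (-j) := by
            rw [abs_of_neg (by exact_mod_cast hneg)] at hle
            exact ⟨by simpa using hneg, by simpa using hle⟩
          rw [if_pos this]
          linarith
        · have : p j := by
            rw [abs_of_pos (by exact_mod_cast hpos)] at hle
            exact ⟨hpos, hle⟩
          rw [if_pos this]
          linarith
      · have hd : 0 < |(j.2 : ℝ)| := abs_pos.mpr (by exact_mod_cast h0)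
        have h1 : G j ≤ 2 * (κ / 2) / (c * |(j.2 : ℝ)|) :=
          (volume_real_mono_Icc (T := {β ∈ Icc ξ η | |linSlope f' (j.1, j.2, 0) β| ≤ κ / 2})
            (fun β hβ => ⟨hβ.1, hβ.2.2⟩) (sep_subset _ _)).trans
            (hA.volume_flat_le (j.1, j.2, 0) (by positivity) h0)
        have h2 : 2 * (κ / 2) / (c * |(j.2 : ℝ)|) ≤ 1 / (c * κ) * δ := by
          rw [div_le_iff₀ (by positivity)]
          have : 1 / (c * κ) * δ * (c * |(j.2 : ℝ)|) = δ * |(j.2 : ℝ)| / κ := by field_simp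
          rw [this, le_div_iff₀ hκ]
          linarith
        linarith
  have hsplit : ∀ j ∈ box, volume.real {β ∈ Icc ξ η | nint (linForm f (j.1, j.2, 0) β) ≤ δ} ≤
      (K₁ + 1 / (c * κ)) * δ + (if p j then G j else 0) + (if p (-j) then G j else 0) := by
    intro j hj
    have hj0 : j.1 ≠ 0 ∨ j.2 ≠ 0 := by
      by_contra! h
      exact (hbox_mem j hj).1 (Prod.ext h.1 h.2)
    have h1 := hsteep (j.1, j.2, 0) hj0 δ hδ hδ1
    set S := {β ∈ Icc ξ η | nint (linForm f (j.1, j.2, 0) β) ≤ δ ∧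
      κ / 2 ≤ |linSlope f' (j.1, j.2, 0) β|} with hS
    have h2 : volume.real {β ∈ Icc ξ η | nint (linForm f (j.1, j.2, 0) β) ≤ δ} ≤
        volume.real (S ∪ nearSet ξ η f f' (κ / 2) δ j) := by
      refine volume_real_mono_Icc ?_ (union_subset (sep_subset _ _) (sep_subset _ _))
      rintro β ⟨hβ, h⟩
      rcases le_total (κ / 2) |linSlope f' (j.1, j.2, 0) β| with h3 | h3
      · exact Or.inl ⟨hβ, h, h3⟩
      · exact Or.inr ⟨hβ, h, h3⟩
    have h3 := measureReal_union_le (μ := volume) S (nearSet ξ η f f' (κ / 2) δ j)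
    have h4 := hGj j hj
    linarith
  have hP := hnear J hJ δ hδ (box.filter p) (by
    intro j hj
    obtain ⟨hj, hp1, hp2⟩ := Finset.mem_filter.mp hj
    exact ⟨(hbox_mem j hj).2.1, hp1, (le_abs_self _).trans (hbox_mem j hj).2.2, hp2⟩)
  have hN : ∑ j ∈ box.filter (fun j => p (-j)), G j = ∑ j ∈ box.filter p, G j := by
    have hneg : ∀ j ∈ box, -j ∈ box := by
      intro j hj
      obtain ⟨h1, h2, h3⟩ := hbox_mem j hj
      have h2 := abs_le.mp h2
      have h3 := abs_le.mp h3
      refine Finset.mem_erase.mpr ⟨fun h => h1 (neg_eq_zero.mp h), Finset.mem_product.mpr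
        ⟨Finset.mem_Icc.mpr ?_, Finset.mem_Icc.mpr ?_⟩⟩
      · exact ⟨neg_le_neg h2.2, neg_le.mp h2.1⟩
      · exact ⟨neg_le_neg h3.2, neg_le.mp h3.1⟩
    refine Finset.sum_nbij' (fun j => -j) (fun j => -j) ?_ ?_ ?_ ?_ ?_
    · intro j hj
      obtain ⟨h1, h2⟩ := Finset.mem_filter.mp hj
      exact Finset.mem_filter.mpr ⟨hneg j h1, h2⟩
    · intro j hj
      obtain ⟨h1, h2⟩ := Finset.mem_filter.mp hj
      exact Finset.mem_filter.mpr ⟨hneg j h1, by rwa [neg_neg]⟩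
    · exact fun j _ => neg_neg j
    · exact fun j _ => neg_neg j
    · exact fun j _ => (hGneg j).symm
  have hcard : (box.card : ℝ) ≤ 9 * (J : ℝ) ^ 2 := by
    have h1 : box.card ≤ (2 * J + 1) * (2 * J + 1) := by
      refine (Finset.card_erase_le).trans (le_of_eq ?_)
      rw [Finset.card_product, Int.card_Icc]
      have : ((J : ℤ) + 1 - -(J : ℤ)).toNat = 2 * J + 1 := by omega
      rw [this]
    have h2 : (box.card : ℝ) ≤ (2 * J + 1) * (2 * J + 1) := by exact_mod_cast h1
    have h3 : (2 : ℝ) ≤ J := by exact_mod_cast hJ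
    nlinarith
  refine (Finset.sum_le_sum hsplit).trans ?_
  rw [Finset.sum_add_distrib, Finset.sum_add_distrib, Finset.sum_const, nsmul_eq_mul,
    ← Finset.sum_filter, ← Finset.sum_filter, hN]
  have t1 := mul_le_mul_of_nonneg_right hcard
    (by positivity : 0 ≤ (K₁ + 1 / (c * κ)) * δ)
  have hlog : 0 ≤ Real.log J := Real.log_natCast_nonneg J
  have t2 : 0 ≤ (K₁ + 1 / (c * κ)) * (√(δ * J) * Real.log J) := by positivity
  have hP' : ∑ j ∈ box.filter p, G j ≤ K₂ * (δ * (J : ℝ) ^ 2 + √(δ * J) * Real.log J) := hP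
  linarith

theorem continuous_nint : Continuous nint := by
  have h : nint = fun y : ℝ => ‖(y : UnitAddCircle)‖ := by
    funext y
    rw [UnitAddCircle.norm_eq]
    rfl
  rw [h]
  exact continuous_norm.comp (AddCircle.continuous_mk' 1)

theorem ite_min_inv_le_sum {q m : ℕ} (hq : q ≤ 2 ^ (m + 1)) {t : ℝ} (ht1 : t ≤ 1) :
    (if t = 0 then (q : ℝ) else min (q : ℝ) t⁻¹) ≤
      ∑ i ∈ Finset.range (m + 1), if t ≤ (1 / 2 : ℝ) ^ i then 2 * (2 : ℝ) ^ i else 0 := by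
  have hterm : ∀ i ∈ Finset.range (m + 1), t ≤ (1 / 2 : ℝ) ^ i →
      2 * (2 : ℝ) ^ i ≤
        ∑ i ∈ Finset.range (m + 1), if t ≤ (1 / 2 : ℝ) ^ i then 2 * (2 : ℝ) ^ i else 0 := by
    intro i hi hti
    have := Finset.single_le_sum (s := Finset.range (m + 1))
      (f := fun i => if t ≤ (1 / 2 : ℝ) ^ i then 2 * (2 : ℝ) ^ i else 0)
      (fun k _ => by split_ifs <;> positivity) hi
    simpa only [if_pos hti] using this
  by_cases htm : t ≤ (1 / 2 : ℝ) ^ m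
  · refine le_trans ?_ (hterm m (Finset.self_mem_range_succ m) htm)
    have hq' : (q : ℝ) ≤ 2 ^ (m + 1) := by exact_mod_cast hq
    have hq'' : (q : ℝ) ≤ 2 * 2 ^ m := by rw [pow_succ] at hq'; linarith
    split_ifs
    · exact hq''
    · exact (min_le_left _ _).trans hq''
  · rw [not_le] at htm
    have ht : 0 < t := lt_trans (by positivity) htm
    obtain ⟨n, hn1, hn2⟩ := exists_nat_pow_near_of_lt_one ht ht1
      (by norm_num : (0 : ℝ) < 1 / 2) (by norm_num)
    have hnm : n < m := by
      by_contra! h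
      have := pow_le_pow_of_le_one (by norm_num : (0 : ℝ) ≤ 1 / 2) (by norm_num) h
      linarith
    refine le_trans ?_ (hterm n (Finset.mem_range.mpr (by omega)) hn2)
    rw [if_neg ht.ne']
    refine (min_le_right _ _).trans (inv_le_of_inv_le₀ (by positivity) (le_trans ?_ hn1.le))
    rw [one_div, inv_pow, pow_succ, mul_comm]

theorem integral_ite_min_inv_le_sum {ξ η : ℝ} {g : ℝ → ℝ} (hg : ContinuousOn g (Icc ξ η))
    {q m : ℕ} (hq : q ≤ 2 ^ (m + 1)) :
    (∫ β in Icc ξ η, if nint (g β) = 0 then (q : ℝ) else min (q : ℝ) (nint (g β))⁻¹) ≤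
      ∑ i ∈ Finset.range (m + 1),
        2 * (2 : ℝ) ^ i * volume.real {β ∈ Icc ξ η | nint (g β) ≤ (1 / 2 : ℝ) ^ i} := by
  have hn : ContinuousOn (fun β => nint (g β)) (Icc ξ η) := continuous_nint.comp_continuousOn hg
  set S : ℕ → Set ℝ := fun i => {β ∈ Icc ξ η | nint (g β) ≤ (1 / 2 : ℝ) ^ i} with hS
  have hSm : ∀ i, MeasurableSet (S i) := fun i =>
    (hn.preimage_isClosed_of_isClosed isClosed_Icc isClosed_Iic).measurableSet
  have hfin : ∀ i, volume (S i) ≠ ⊤ := fun i =>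
    measure_ne_top_of_subset (sep_subset _ _) measure_Icc_lt_top.ne
  have hint : ∀ i, Integrable ((S i).indicator fun _ => 2 * (2 : ℝ) ^ i)
      (volume.restrict (Icc ξ η)) := fun i =>
    (integrable_const _).indicator (hSm i)
  have heq : ∀ i, 2 * (2 : ℝ) ^ i * volume.real (S i) =
      ∫ β in Icc ξ η, (S i).indicator (fun _ => 2 * (2 : ℝ) ^ i) β := by
    intro i
    rw [integral_indicator_const _ (hSm i), measureReal_restrict_apply (hSm i),
      inter_eq_left.mpr (sep_subset _ _), smul_eq_mul, mul_comm]
  rw [Finset.sum_congr rfl fun i _ => heq i, ← integral_finsetSum _ fun i _ => hint i]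
  refine integral_mono_of_nonneg (Filter.Eventually.of_forall fun β => ?_)
    (integrable_finsetSum _ fun i _ => hint i) ?_
  · have : 0 ≤ (nint (g β))⁻¹ := inv_nonneg.mpr (abs_nonneg _)
    dsimp only [Pi.zero_apply]
    split_ifs <;> positivity
  · refine (ae_restrict_iff' measurableSet_Icc).mpr (Filter.Eventually.of_forall fun β hβ => ?_)
    refine (ite_min_inv_le_sum hq
      ((abs_sub_round (g β)).trans (by norm_num))).trans (le_of_eq ?_)
    refine Finset.sum_congr rfl fun i _ => ?_
    simp only [indicator_apply, hS, mem_sep_iff, hβ, true_and, nint]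

theorem sqrt_pow_eq {x : ℝ} (hx : 0 ≤ x) (n : ℕ) : √(x ^ n) = √x ^ n := by
  rw [Real.sqrt_eq_iff_mul_self_eq (by positivity) (by positivity), ← mul_pow,
    Real.mul_self_sqrt hx]

theorem sum_pow_mul_dyadic_le {K A B : ℝ} {q m : ℕ} (hK : 0 ≤ K) (hA : 0 ≤ A) (hB : 0 ≤ B)
    (hq : 2 ≤ q) (hmq : 2 ^ m ≤ q) :
    ∑ i ∈ Finset.range (m + 1),
        2 * (2 : ℝ) ^ i * (K * ((1 / 2 : ℝ) ^ i * A + √((1 / 2 : ℝ) ^ i) * B)) ≤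
      8 * K * (A * Real.log q + √q * B) := by
  have hmq' : (2 : ℝ) ^ m ≤ q := by exact_mod_cast hmq
  have hq' : (2 : ℝ) ≤ q := by exact_mod_cast hq
  have hs : √(2 : ℝ) ^ 2 = 2 := Real.sq_sqrt (by norm_num)
  have hterm : ∀ i : ℕ,
      2 * (2 : ℝ) ^ i * (K * ((1 / 2 : ℝ) ^ i * A + √((1 / 2 : ℝ) ^ i) * B)) =
        2 * K * A + 2 * K * B * √2 ^ i := by
    intro i
    have e1 : (2 : ℝ) ^ i * (1 / 2 : ℝ) ^ i = 1 := by
      rw [← mul_pow]; norm_num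
    have e2 : √((1 / 2 : ℝ) ^ i) * √2 ^ i = 1 := by
      rw [← sqrt_pow_eq (by norm_num), ← Real.sqrt_mul (by positivity), ← mul_pow]; norm_num
    have e3 : (2 : ℝ) ^ i = √2 ^ i * √2 ^ i := by rw [← mul_pow, ← sq, hs]
    have e4 : (2 : ℝ) ^ i * √((1 / 2 : ℝ) ^ i) = √2 ^ i := by
      rw [e3, mul_assoc, mul_comm (√2 ^ i) (√((1 / 2 : ℝ) ^ i)), e2, mul_one]
    linear_combination 2 * K * A * e1 + 2 * K * B * e4
  rw [Finset.sum_congr rfl fun i _ => hterm i, Finset.sum_add_distrib, Finset.sum_const,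
    Finset.card_range, nsmul_eq_mul, ← Finset.mul_sum]
  have h43 : (4 / 3 : ℝ) ≤ √2 := Real.le_sqrt_of_sq_le (by norm_num)
  have hgeo := sum_range_succ_pow_le h43 m
  have hsm : √2 ^ m ≤ √(q : ℝ) := by
    rw [← sqrt_pow_eq (by norm_num)]
    exact Real.sqrt_le_sqrt hmq'
  have hl2 := Real.log_two_gt_d9
  have hlq : Real.log 2 ≤ Real.log q := Real.log_le_log (by norm_num) hq'
  have hlm : m * Real.log 2 ≤ Real.log q := by
    rw [← Real.log_pow]
    exact Real.log_le_log (by positivity) hmq'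
  have hm : ((m + 1 : ℕ) : ℝ) ≤ 4 * Real.log q := by
    push_cast
    nlinarith [(Nat.cast_nonneg m : (0 : ℝ) ≤ m)]
  have t1 : ((m + 1 : ℕ) : ℝ) * (2 * K * A) ≤ 4 * Real.log q * (2 * K * A) :=
    mul_le_mul_of_nonneg_right hm (by positivity)
  have t2 : 2 * K * B * ∑ i ∈ Finset.range (m + 1), √2 ^ i ≤ 2 * K * B * (4 * √(q : ℝ)) :=
    mul_le_mul_of_nonneg_left (by linarith) (by positivity)
  linarith

theorem sum_integral_min_bound
    (ξ η c₁ c₂ : ℝ) (hξη : ξ ≤ η) (hc₁ : 0 < c₁)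
    (f f' f'' : ℝ → ℝ)
    (hf : ∀ x ∈ Icc ξ η, HasDerivWithinAt f (f' x) (Icc ξ η) x)
    (hf' : ∀ x ∈ Icc ξ η, HasDerivWithinAt f' (f'' x) (Icc ξ η) x)
    (hf'' : ContinuousOn f'' (Icc ξ η))
    (hbd : ∀ x ∈ Icc ξ η, c₁ ≤ |f'' x| ∧ |f'' x| ≤ c₂) :
    ∃ K : ℝ, 0 < K ∧ ∀ J q₀ : ℕ, 2 ≤ J → 2 ≤ q₀ →
      ∑ j ∈ (Finset.Icc (-(J : ℤ)) J ×ˢ Finset.Icc (-(J : ℤ)) J).erase (0, 0),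
        (∫ β in Icc ξ η,
          if nint ((j.1 : ℝ) * β + (j.2 : ℝ) * f β) = 0 then (q₀ : ℝ)
          else min (q₀ : ℝ) (nint ((j.1 : ℝ) * β + (j.2 : ℝ) * f β))⁻¹)
      ≤ K * ((J : ℝ) ^ 2 * Real.log q₀
              + (q₀ : ℝ) ^ ((1 : ℝ)/2) * (J : ℝ) ^ ((1 : ℝ)/2) * Real.log J) := by
  obtain ⟨c, C, hA⟩ := exists_curvedArc hξη hc₁ hf hf' hbd
  obtain ⟨K, hK, hKle⟩ := hA.exists_sum_volume_nint_le
  refine ⟨8 * K, by positivity, ?_⟩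
  intro J q₀ hJ hq₀
  set m := Nat.log 2 q₀ with hm
  have hm1 : 2 ^ m ≤ q₀ := Nat.pow_log_le_self 2 (by omega)
  have hm2 : q₀ ≤ 2 ^ (m + 1) := (Nat.lt_pow_succ_log_self (by norm_num) q₀).le
  have hfc : ContinuousOn f (Icc ξ η) := continuousOn_of_hasDerivWithinAt hf
  have hlogJ : 0 ≤ Real.log J := Real.log_natCast_nonneg J
  refine (Finset.sum_le_sum fun j _ => integral_ite_min_inv_le_sum
    (g := fun β => (j.1 : ℝ) * β + (j.2 : ℝ) * f β) (by fun_prop) hm2).trans ?_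
  rw [Finset.sum_comm, ← Real.sqrt_eq_rpow, ← Real.sqrt_eq_rpow, mul_assoc (√(q₀ : ℝ))]
  refine le_trans (Finset.sum_le_sum fun i _ => ?_)
    (sum_pow_mul_dyadic_le hK.le (by positivity) (by positivity) hq₀ hm1)
  rw [← Finset.mul_sum]
  have h := hKle J hJ ((1 / 2 : ℝ) ^ i) (by positivity) (pow_le_one₀ (by norm_num) (by norm_num))
  simp only [linForm, Int.cast_zero, add_zero] at h
  rw [Real.sqrt_mul (by positivity), mul_assoc (√((1 / 2 : ℝ) ^ i))] at h
  exact mul_le_mul_of_nonneg_left h (by positivity)
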